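/- Let f ∈ Λ_p, 1<p<∞, α₁,α₂>0, and n₁,n₂ ∈ {0,1,2,...}. Then ω_{α₁,α₂}(f, 2^{−n₁}, 2^{−n₂})_p ≍ 2^{−n₁α₁−n₂α₂}{Σ_{μ₁=0}^{n₁}Σ_{μ₂=0}^{n₂} λ_{μ₁,μ₂}² 2^{2(μ₁α₁+μ₂α₂)}}^{1/2} + 2^{−n₁α₁}{Σ_{μ₁=0}^{n₁}Σ_{μ₂=n₂+1}^∞ λ_{μ₁,μ₂}² 2^{2μ₁α₁}}^{1/2} + 2^{−n₂α₂}{Σ_{μ₁=n₁+1}^∞Σ_{μ₂=0}^{n₂} λ_{μ₁,μ₂}² 2^{2μ₂α₂}}^{1/2} + {Σ_{μ₁=n₁+1}^∞Σ_{μ₂=n₂+1}^∞ λ_{μ₁,μ₂}²}^{1/2}, with constants independent of f, n₁, n₂. -/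

import Mathlib

open MeasureTheory Real
open scoped ENNReal

noncomputable section

/-- The `L_p` norm of a function of two variables over the period square `(0,2π]²`. -/
def Lp2Norm (p : ℝ) (f : ℝ → ℝ → ℝ) : ℝ≥0∞ :=
  (∫⁻ x in Set.Ioc (0:ℝ) (2*π), ∫⁻ y in Set.Ioc (0:ℝ) (2*π),
      ENNReal.ofReal (|f x y| ^ p)) ^ (1/p)

/-- `f ∈ L_p^0(T²)`: measurable, `2π`-periodic in each variable, finite `L_p` norm,
and zero mean in each variable separately. -/
structure MemLp0 (p : ℝ) (f : ℝ → ℝ → ℝ) : Prop where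
  meas : Measurable (Function.uncurry f)
  periodic_x : ∀ y, Function.Periodic (fun x => f x y) (2*π)
  periodic_y : ∀ x, Function.Periodic (f x) (2*π)
  norm_ne_top : Lp2Norm p f ≠ ⊤
  mean_x : ∀ᵐ (y : ℝ) ∂volume, (∫ x in (0:ℝ)..(2*π), f x y) = 0
  mean_y : ∀ᵐ (x : ℝ) ∂volume, (∫ y in (0:ℝ)..(2*π), f x y) = 0

/-- Generalized (fractional) binomial coefficient `C(α,ν) = α(α-1)⋯(α-ν+1)/ν!`. -/
def fracBinom (α : ℝ) : ℕ → ℝ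
  | 0 => 1
  | n+1 => fracBinom α n * (α - (n : ℝ)) / ((n : ℝ) + 1)

/-- Fractional difference of order `α` with step `h` in the first variable. -/
def diffX (α h : ℝ) (f : ℝ → ℝ → ℝ) : ℝ → ℝ → ℝ :=
  fun x y => ∑' ν : ℕ, (-1 : ℝ) ^ ν * fracBinom α ν * f (x + (α - (ν : ℝ)) * h) y

/-- Fractional difference of order `α` with step `h` in the second variable. -/
def diffY (α h : ℝ) (f : ℝ → ℝ → ℝ) : ℝ → ℝ → ℝ :=
  fun x y => ∑' ν : ℕ, (-1 : ℝ) ^ ν * fracBinom α ν * f x (y + (α - (ν : ℝ)) * h)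

/-- The mixed (fractional) modulus of smoothness `ω_{α₁,α₂}(f, δ₁, δ₂)_p`. -/
def mixedMod (p α₁ α₂ δ₁ δ₂ : ℝ) (f : ℝ → ℝ → ℝ) : ℝ≥0∞ :=
  ⨆ (h₁ : ℝ) (_ : |h₁| ≤ δ₁) (h₂ : ℝ) (_ : |h₂| ≤ δ₂),
    Lp2Norm p (diffX α₁ h₁ (diffY α₂ h₂ f))

/-- Cosine-cosine Fourier coefficient `a_{n₁,n₂}` of `f`. -/
def fourierCC (f : ℝ → ℝ → ℝ) (n₁ n₂ : ℕ) : ℝ :=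
  (1/π^2) * ∫ x in (0:ℝ)..(2*π), ∫ y in (0:ℝ)..(2*π),
    f x y * Real.cos ((n₁ : ℝ) * x) * Real.cos ((n₂ : ℝ) * y)

/-- Sine-cosine Fourier coefficient `b_{n₁,n₂}` of `f`. -/
def fourierSC (f : ℝ → ℝ → ℝ) (n₁ n₂ : ℕ) : ℝ :=
  (1/π^2) * ∫ x in (0:ℝ)..(2*π), ∫ y in (0:ℝ)..(2*π),
    f x y * Real.sin ((n₁ : ℝ) * x) * Real.cos ((n₂ : ℝ) * y)

/-- Cosine-sine Fourier coefficient `c_{n₁,n₂}` of `f`. -/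
def fourierCS (f : ℝ → ℝ → ℝ) (n₁ n₂ : ℕ) : ℝ :=
  (1/π^2) * ∫ x in (0:ℝ)..(2*π), ∫ y in (0:ℝ)..(2*π),
    f x y * Real.cos ((n₁ : ℝ) * x) * Real.sin ((n₂ : ℝ) * y)

/-- Sine-sine Fourier coefficient `d_{n₁,n₂}` of `f`. -/
def fourierSS (f : ℝ → ℝ → ℝ) (n₁ n₂ : ℕ) : ℝ :=
  (1/π^2) * ∫ x in (0:ℝ)..(2*π), ∫ y in (0:ℝ)..(2*π),
    f x y * Real.sin ((n₁ : ℝ) * x) * Real.sin ((n₂ : ℝ) * y)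

/-- The class `Λ_p`: `f ∈ L_p^0(T²)` with lacunary Fourier series
`Σ λ_{μ₁,μ₂} cos 2^{μ₁}x cos 2^{μ₂}y`. -/
def InLambdaClass (p : ℝ) (f : ℝ → ℝ → ℝ) (lam : ℕ → ℕ → ℝ) : Prop :=
  MemLp0 p f ∧
  (∀ μ₁ μ₂ : ℕ, fourierCC f (2^μ₁) (2^μ₂) = lam μ₁ μ₂) ∧
  (∀ n₁ n₂ : ℕ, (¬ ∃ μ₁ μ₂ : ℕ, n₁ = 2^μ₁ ∧ n₂ = 2^μ₂) → fourierCC f n₁ n₂ = 0) ∧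
  (∀ n₁ n₂ : ℕ, fourierSC f n₁ n₂ = 0 ∧ fourierCS f n₁ n₂ = 0 ∧ fourierSS f n₁ n₂ = 0)

/-- The four-term quantity of Theorem 7.3 for lacunary coefficients `lam`. -/
def Lfun (lam : ℕ → ℕ → ℝ) (α₁ α₂ : ℝ) (n₁ n₂ : ℕ) : ℝ≥0∞ :=
  ENNReal.ofReal ((2:ℝ) ^ (-((n₁:ℝ)*α₁ + (n₂:ℝ)*α₂))) *
    (∑ μ₁ ∈ Finset.range (n₁+1), ∑ μ₂ ∈ Finset.range (n₂+1),
      ENNReal.ofReal (lam μ₁ μ₂ ^ 2 *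
        (2:ℝ) ^ (2*((μ₁:ℝ)*α₁ + (μ₂:ℝ)*α₂)))) ^ ((1:ℝ)/2)
  + ENNReal.ofReal ((2:ℝ) ^ (-(n₁:ℝ)*α₁)) *
    (∑ μ₁ ∈ Finset.range (n₁+1), ∑' k : ℕ,
      ENNReal.ofReal (lam μ₁ (n₂+1+k) ^ 2 * (2:ℝ) ^ (2*(μ₁:ℝ)*α₁))) ^ ((1:ℝ)/2)
  + ENNReal.ofReal ((2:ℝ) ^ (-(n₂:ℝ)*α₂)) *
    (∑ μ₂ ∈ Finset.range (n₂+1), ∑' k : ℕ,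
      ENNReal.ofReal (lam (n₁+1+k) μ₂ ^ 2 * (2:ℝ) ^ (2*(μ₂:ℝ)*α₂))) ^ ((1:ℝ)/2)
  + (∑' (j : ℕ) (k : ℕ), ENNReal.ofReal (lam (n₁+1+j) (n₂+1+k) ^ 2)) ^ ((1:ℝ)/2)

/-- The `k`-th dyadic cosine wave with phase `θ k`. -/
def dyadicWave (θ : ℕ → ℝ) (k : ℕ) (x : ℝ) : ℝ := Real.cos (2 ^ k * x + θ k)

lemma continuous_dyadicWave (θ : ℕ → ℝ) (k : ℕ) : Continuous (dyadicWave θ k) := by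
  unfold dyadicWave; fun_prop

lemma abs_dyadicWave_le_one (θ : ℕ → ℝ) (k : ℕ) (x : ℝ) : |dyadicWave θ k x| ≤ 1 :=
  Real.abs_cos_le_one _

lemma integral_eq_zero_of_antiperiodic {g : ℝ → ℝ} {c : ℝ} {n : ℕ}
    (hg : Function.Antiperiodic g c) (hn : (n : ℝ) * (2 * c) = 2 * π) :
    ∫ x in (0:ℝ)..(2*π), g x = 0 := by
  have hper : Function.Periodic g (2 * π) := by
    have h := hg.periodic_two_mul.nat_mul n
    rwa [hn] at h
  have h1 : ∫ x in (0:ℝ)..(2*π), g x = ∫ x in (0:ℝ)..(2*π), g (x + c) := by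
    rw [intervalIntegral.integral_comp_add_right]
    have h2 := hper.intervalIntegral_add_eq 0 c
    simpa [add_comm] using h2
  have h3 : ∫ x in (0:ℝ)..(2*π), g (x + c) = - ∫ x in (0:ℝ)..(2*π), g x := by
    rw [← intervalIntegral.integral_neg]
    congr 1
    ext x
    exact hg x
  linarith

lemma dyadicWave_add_of_lt (θ : ℕ → ℝ) {j k : ℕ} (h : j < k) (x : ℝ) :
    dyadicWave θ k (x + π / 2 ^ j) = dyadicWave θ k x := by
  obtain ⟨i, rfl⟩ := Nat.exists_eq_add_of_lt h
  unfold dyadicWave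
  have : (2:ℝ) ^ (j + i + 1) * (x + π / 2 ^ j) + θ (j + i + 1)
      = 2 ^ (j + i + 1) * x + θ (j + i + 1) + ((2 ^ i : ℕ) : ℝ) * (2 * π) := by
    push_cast
    field_simp
    ring
  rw [this, Real.cos_add_nat_mul_two_pi]

lemma dyadicWave_add_self (θ : ℕ → ℝ) (j : ℕ) (x : ℝ) :
    dyadicWave θ j (x + π / 2 ^ j) = - dyadicWave θ j x := by
  unfold dyadicWave
  have : (2:ℝ) ^ j * (x + π / 2 ^ j) + θ j = 2 ^ j * x + θ j + π := by
    field_simp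
    ring
  rw [this, Real.cos_add_pi]

/-- Riesz products over the dyadic frequencies integrate factor by factor. -/
lemma integral_rieszProduct (θ A B : ℕ → ℝ) (n j : ℕ) :
    ∫ x in (0:ℝ)..(2*π), ∏ i ∈ Finset.range n, (A (j+i) + B (j+i) * dyadicWave θ (j+i) x)
      = 2 * π * ∏ i ∈ Finset.range n, A (j+i) := by
  induction n generalizing j with
  | zero => simp
  | succ n ih =>
    set Q : ℝ → ℝ := fun x =>
      ∏ i ∈ Finset.range n, (A (j+1+i) + B (j+1+i) * dyadicWave θ (j+1+i) x) with hQ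
    have hQc : Continuous Q :=
      continuous_finsetProd _ fun i _ =>
        continuous_const.add (continuous_const.mul (continuous_dyadicWave _ _))
    have hW := continuous_dyadicWave θ j
    have h1 : ∀ x, ∏ i ∈ Finset.range (n+1), (A (j+i) + B (j+i) * dyadicWave θ (j+i) x)
        = A j * Q x + B j * (dyadicWave θ j x * Q x) := by
      intro x
      rw [Finset.prod_range_succ', add_zero, mul_add, hQ]
      have : ∏ i ∈ Finset.range n, (A (j+(i+1)) + B (j+(i+1)) * dyadicWave θ (j+(i+1)) x)
          = ∏ i ∈ Finset.range n, (A (j+1+i) + B (j+1+i) * dyadicWave θ (j+1+i) x) :=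
        Finset.prod_congr rfl fun i _ => by rw [show j + (i + 1) = j + 1 + i by omega]
      rw [this]
      ring
    have hzero : ∫ x in (0:ℝ)..(2*π), dyadicWave θ j x * Q x = 0 := by
      refine integral_eq_zero_of_antiperiodic (c := π / 2 ^ j) (n := 2 ^ j) ?_ ?_
      · intro x
        have : Q (x + π / 2 ^ j) = Q x := by
          simp only [hQ]
          refine Finset.prod_congr rfl fun i _ => ?_
          rw [dyadicWave_add_of_lt θ (by omega)]
        simp only [this, dyadicWave_add_self]
        ring
      · push_cast
        field_simp
    simp only [h1]
    rw [intervalIntegral.integral_add, intervalIntegral.integral_const_mul,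
      intervalIntegral.integral_const_mul, hzero, hQ, ih (j+1), Finset.prod_range_succ']
    · have : ∀ i, A (j + (i + 1)) = A (j + 1 + i) := fun i => by congr 1; omega
      simp_rw [this, add_zero]
      ring
    · exact (continuous_const.mul hQc).intervalIntegrable _ _
    · exact (continuous_const.mul (hW.mul hQc)).intervalIntegrable _ _

/-- Dyadic cosine sums are subgaussian. -/
lemma integral_exp_dyadicSum_le (θ A : ℕ → ℝ) (n : ℕ) :
    ∫ x in (0:ℝ)..(2*π), Real.exp (∑ i ∈ Finset.range n, A i * dyadicWave θ i x)
      ≤ 2 * π * Real.exp ((∑ i ∈ Finset.range n, A i ^ 2) / 2) := by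
  have hc := continuous_dyadicWave θ
  calc ∫ x in (0:ℝ)..(2*π), Real.exp (∑ i ∈ Finset.range n, A i * dyadicWave θ i x)
      ≤ ∫ x in (0:ℝ)..(2*π), ∏ i ∈ Finset.range n,
          (Real.cosh (A i) + Real.sinh (A i) * dyadicWave θ i x) := by
        refine intervalIntegral.integral_mono_on (by positivity) ?_ ?_ ?_
        · exact Continuous.intervalIntegrable (by fun_prop) _ _
        · exact Continuous.intervalIntegrable (by fun_prop) _ _
        · intro x _
          rw [Real.exp_sum]
          refine Finset.prod_le_prod (fun i _ => (Real.exp_pos _).le) fun i _ => ?_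
          have := Real.exp_mul_le_cosh_add_mul_sinh (abs_dyadicWave_le_one θ i x) (A i)
          rw [mul_comm (A i)]
          linarith
    _ = 2 * π * ∏ i ∈ Finset.range n, Real.cosh (A i) := by
        have := integral_rieszProduct θ (fun i => Real.cosh (A i)) (fun i => Real.sinh (A i)) n 0
        simpa using this
    _ ≤ 2 * π * Real.exp ((∑ i ∈ Finset.range n, A i ^ 2) / 2) := by
        rw [Finset.sum_div, Real.exp_sum]
        gcongr with i _
        exact Real.cosh_le_exp_half_sq _

/-- The constant in the `2r`-th moment estimate for dyadic cosine sums. -/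
def dyadicMomentConst (r : ℕ) : ℝ := 4 * π * Real.exp (1 / 2) * (2 * r).factorial

lemma dyadicMomentConst_pos (r : ℕ) : 0 < dyadicMomentConst r := by
  unfold dyadicMomentConst; positivity

lemma pow_le_factorial_mul_exp_add_exp (s : ℝ) (r : ℕ) :
    s ^ (2 * r) ≤ (2 * r).factorial * (Real.exp s + Real.exp (-s)) := by
  have h := Real.pow_div_factorial_le_exp |s| (abs_nonneg s) (2 * r)
  rw [div_le_iff₀ (by positivity), (even_two_mul r).pow_abs] at h
  have h2 : Real.exp |s| ≤ Real.exp s + Real.exp (-s) := by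
    rcases abs_cases s with ⟨h, _⟩ | ⟨h, _⟩ <;> rw [h] <;>
      linarith [Real.exp_pos s, Real.exp_pos (-s)]
  calc s ^ (2 * r) ≤ Real.exp |s| * (2 * r).factorial := h
    _ ≤ _ := by rw [mul_comm]; gcongr

/-- Even moments of one-dimensional dyadic cosine sums. -/
lemma integral_dyadicSum_pow_le (θ A : ℕ → ℝ) (n : ℕ) {r : ℕ} (hr : r ≠ 0) :
    ∫ x in (0:ℝ)..(2*π), (∑ i ∈ Finset.range n, A i * dyadicWave θ i x) ^ (2 * r)
      ≤ dyadicMomentConst r * (∑ i ∈ Finset.range n, A i ^ 2) ^ r := by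
  have hc := continuous_dyadicWave θ
  set V := ∑ i ∈ Finset.range n, A i ^ 2 with hV
  have hV0 : 0 ≤ V := Finset.sum_nonneg fun i _ => sq_nonneg _
  rcases hV0.eq_or_lt with h0 | hpos
  · have hA : ∀ i ∈ Finset.range n, A i = 0 := fun i hi => by
      have := (Finset.sum_eq_zero_iff_of_nonneg (fun i _ => sq_nonneg (A i))).1 (hV ▸ h0.symm) i hi
      simpa using this
    have hS : ∀ x, ∑ i ∈ Finset.range n, A i * dyadicWave θ i x = 0 := fun x =>
      Finset.sum_eq_zero fun i hi => by rw [hA i hi, zero_mul]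
    simp [hS, ← h0, hr]
  set s := Real.sqrt V with hs
  have hs0 : 0 < s := Real.sqrt_pos.2 hpos
  have hsq : s ^ 2 = V := Real.sq_sqrt hV0
  have key : ∀ ε : ℝ, ε ^ 2 = 1 →
      ∫ x in (0:ℝ)..(2*π), Real.exp (ε * ((∑ i ∈ Finset.range n, A i * dyadicWave θ i x) / s))
        ≤ 2 * π * Real.exp (1 / 2) := by
    intro ε hε
    have h := integral_exp_dyadicSum_le θ (fun i => ε * A i / s) n
    have h1 : ∑ i ∈ Finset.range n, (ε * A i / s) ^ 2 = 1 := by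
      have : ∀ i, (ε * A i / s) ^ 2 = A i ^ 2 / V := fun i => by
        rw [div_pow, mul_pow, hε, one_mul, hsq]
      simp only [this]
      rw [← Finset.sum_div, ← hV, div_self hpos.ne']
    rw [h1] at h
    refine le_of_eq_of_le ?_ h
    congr 1
    ext x
    rw [Finset.sum_div, Finset.mul_sum]
    congr 1
    exact Finset.sum_congr rfl fun i _ => by ring
  have kp := key 1 (by norm_num)
  have km := key (-1) (by norm_num)
  simp only [one_mul, neg_mul] at kp km
  calc ∫ x in (0:ℝ)..(2*π), (∑ i ∈ Finset.range n, A i * dyadicWave θ i x) ^ (2 * r)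
      ≤ ∫ x in (0:ℝ)..(2*π), V ^ r * (2 * r).factorial *
          (Real.exp ((∑ i ∈ Finset.range n, A i * dyadicWave θ i x) / s)
            + Real.exp (-((∑ i ∈ Finset.range n, A i * dyadicWave θ i x) / s))) := by
        refine intervalIntegral.integral_mono_on (by positivity) ?_ ?_ ?_
        · exact Continuous.intervalIntegrable (by fun_prop) _ _
        · exact Continuous.intervalIntegrable (by fun_prop) _ _
        · intro x _
          have h := pow_le_factorial_mul_exp_add_exp
            ((∑ i ∈ Finset.range n, A i * dyadicWave θ i x) / s) r
          rw [div_pow, pow_mul s, hsq, div_le_iff₀ (by positivity)] at h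
          linarith
    _ ≤ V ^ r * (2 * r).factorial * (2 * π * Real.exp (1 / 2) + 2 * π * Real.exp (1 / 2)) := by
        rw [intervalIntegral.integral_const_mul, intervalIntegral.integral_add]
        · gcongr
        · exact Continuous.intervalIntegrable (by fun_prop) _ _
        · exact Continuous.intervalIntegrable (by fun_prop) _ _
    _ = dyadicMomentConst r * V ^ r := by
        unfold dyadicMomentConst; ring

/-- Weighted power mean inequality in the form used to integrate out the second variable. -/
lemma sum_sq_pow_le {ι : Type*} (s : Finset ι) (a w : ι → ℝ) (hw : ∀ i ∈ s, 0 < w i) (r : ℕ) :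
    (∑ i ∈ s, a i ^ 2) ^ (r + 1)
      ≤ (∑ i ∈ s, w i) ^ r * ∑ i ∈ s, a i ^ (2 * (r + 1)) / w i ^ r := by
  rcases s.eq_empty_or_nonempty with rfl | hne
  · simp
  have hW : 0 < ∑ i ∈ s, w i := Finset.sum_pos hw hne
  set W := ∑ i ∈ s, w i with hWdef
  have h := Real.pow_arith_mean_le_arith_mean_pow s (fun i => w i / W) (fun i => a i ^ 2 / w i)
    (fun i hi => div_nonneg (hw i hi).le hW.le)
    (by rw [← Finset.sum_div, ← hWdef, div_self hW.ne'])
    (fun i hi => div_nonneg (sq_nonneg _) (hw i hi).le) (r + 1)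
  have h1 : ∑ i ∈ s, w i / W * (a i ^ 2 / w i) = (∑ i ∈ s, a i ^ 2) / W := by
    rw [Finset.sum_div]
    refine Finset.sum_congr rfl fun i hi => ?_
    have := (hw i hi).ne'
    field_simp
  have h2 : ∑ i ∈ s, w i / W * (a i ^ 2 / w i) ^ (r + 1)
      = (∑ i ∈ s, a i ^ (2 * (r + 1)) / w i ^ r) / W := by
    rw [Finset.sum_div]
    refine Finset.sum_congr rfl fun i hi => ?_
    have := (hw i hi).ne'
    rw [div_pow, ← pow_mul, pow_succ (w i)]
    field_simp
  simp only [h1, h2] at h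
  rw [div_pow, div_le_iff₀ (by positivity)] at h
  calc _ ≤ _ := h
    _ = _ := by rw [pow_succ W]; field_simp

/-- Even moments of two-dimensional dyadic cosine sums. -/
lemma integral_integral_dyadicSum_pow_le (θ η : ℕ → ℝ) (d : ℕ → ℕ → ℝ) (n r : ℕ) :
    ∫ x in (0:ℝ)..(2*π), ∫ y in (0:ℝ)..(2*π),
      (∑ i ∈ Finset.range n, ∑ j ∈ Finset.range n,
        d i j * dyadicWave θ i x * dyadicWave η j y) ^ (2 * (r + 1))
      ≤ dyadicMomentConst (r + 1) ^ 2 *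
        (∑ i ∈ Finset.range n, ∑ j ∈ Finset.range n, d i j ^ 2) ^ (r + 1) := by
  have hcθ := continuous_dyadicWave θ
  have hcη := continuous_dyadicWave η
  set K := dyadicMomentConst (r + 1) with hK
  have hK0 : 0 < K := dyadicMomentConst_pos _
  set a : ℕ → ℝ → ℝ := fun j x => ∑ i ∈ Finset.range n, d i j * dyadicWave θ i x with ha
  have hac : ∀ j, Continuous (a j) := fun j => by simp only [ha]; fun_prop
  set w : ℕ → ℝ := fun j => ∑ i ∈ Finset.range n, d i j ^ 2 with hw
  have hw0 : ∀ j, 0 ≤ w j := fun j => Finset.sum_nonneg fun i _ => sq_nonneg _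
  set s := (Finset.range n).filter (fun j => 0 < w j) with hs
  have hsum : ∑ i ∈ Finset.range n, ∑ j ∈ Finset.range n, d i j ^ 2 = ∑ j ∈ s, w j := by
    rw [Finset.sum_comm, hs, Finset.sum_filter_of_ne]
    intro j _ hj
    exact lt_of_le_of_ne (hw0 j) (Ne.symm hj)
  have haz : ∀ j x, ¬ 0 < w j → a j x = 0 := by
    intro j x hj
    have h0 : w j = 0 := le_antisymm (not_lt.1 hj) (hw0 j)
    have := (Finset.sum_eq_zero_iff_of_nonneg (fun i _ => sq_nonneg (d i j))).1 h0
    refine Finset.sum_eq_zero fun i hi => ?_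
    have := this i hi
    simp at this
    simp [this]
  have hasum : ∀ x, ∑ j ∈ Finset.range n, a j x ^ 2 = ∑ j ∈ s, a j x ^ 2 := by
    intro x
    rw [hs, Finset.sum_filter_of_ne]
    intro j _ hj
    by_contra h
    exact hj (by rw [haz j x h]; simp)
  have hS : ∀ x y, ∑ i ∈ Finset.range n, ∑ j ∈ Finset.range n,
      d i j * dyadicWave θ i x * dyadicWave η j y
        = ∑ j ∈ Finset.range n, a j x * dyadicWave η j y := by
    intro x y
    rw [Finset.sum_comm]
    simp only [ha, Finset.sum_mul]
  simp only [hS]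
  have hinner : ∀ x, ∫ y in (0:ℝ)..(2*π),
      (∑ j ∈ Finset.range n, a j x * dyadicWave η j y) ^ (2 * (r + 1))
        ≤ K * ((∑ j ∈ s, w j) ^ r * ∑ j ∈ s, a j x ^ (2 * (r + 1)) / w j ^ r) := by
    intro x
    refine (integral_dyadicSum_pow_le η (fun j => a j x) n r.succ_ne_zero).trans ?_
    rw [hasum x]
    gcongr
    exact sum_sq_pow_le s (fun j => a j x) w (fun j hj => (Finset.mem_filter.1 hj).2) r
  have hcont : Continuous fun x => ∫ y in (0:ℝ)..(2*π),
      (∑ j ∈ Finset.range n, a j x * dyadicWave η j y) ^ (2 * (r + 1)) := by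
    refine intervalIntegral.continuous_parametric_intervalIntegral_of_continuous' ?_ _ _
    simp only [Function.uncurry_def]
    fun_prop
  calc _ ≤ ∫ x in (0:ℝ)..(2*π),
        K * ((∑ j ∈ s, w j) ^ r * ∑ j ∈ s, a j x ^ (2 * (r + 1)) / w j ^ r) := by
        refine intervalIntegral.integral_mono_on (by positivity) ?_ ?_ fun x _ => hinner x
        · exact hcont.intervalIntegrable _ _
        · exact Continuous.intervalIntegrable (by fun_prop) _ _
    _ = K * ((∑ j ∈ s, w j) ^ r * ∑ j ∈ s, (∫ x in (0:ℝ)..(2*π), a j x ^ (2 * (r + 1)))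
          / w j ^ r) := by
        rw [intervalIntegral.integral_const_mul, intervalIntegral.integral_const_mul,
          intervalIntegral.integral_finsetSum]
        · simp only [intervalIntegral.integral_div]
        · intro j _
          exact Continuous.intervalIntegrable (by fun_prop) _ _
    _ ≤ K * ((∑ j ∈ s, w j) ^ r * ∑ j ∈ s, K * w j) := by
        have : ∀ j ∈ s, (∫ x in (0:ℝ)..(2*π), a j x ^ (2 * (r + 1))) / w j ^ r ≤ K * w j := by
          intro j hj
          have hwj : 0 < w j := (Finset.mem_filter.1 hj).2
          rw [div_le_iff₀ (by positivity)]
          refine (integral_dyadicSum_pow_le θ (fun i => d i j) n r.succ_ne_zero).trans ?_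
          rw [pow_succ]
          apply le_of_eq
          ring
        have h0 : 0 ≤ ∑ j ∈ s, w j := Finset.sum_nonneg fun j _ => hw0 j
        gcongr with j hj
        exact this j hj
    _ = _ := by
        rw [hsum, ← Finset.mul_sum, pow_succ (∑ j ∈ s, w j)]
        ring

/-- The coefficient of the `ν`-th shift in the fractional difference of order `α`. -/
def diffCoeff (α : ℝ) (ν : ℕ) : ℝ := (-1 : ℝ) ^ ν * fracBinom α ν

lemma fracBinom_eq_choose (α : ℝ) (n : ℕ) : fracBinom α n = Ring.choose α n := by
  induction n with
  | zero => simp [fracBinom]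
  | succ n ih =>
    rw [fracBinom, ih, Ring.choose_eq_smul, Ring.choose_eq_smul, descPochhammer_succ_right,
      Polynomial.smeval_mul, Nat.factorial_succ]
    simp only [Polynomial.smeval_sub, Polynomial.smeval_X, Polynomial.smeval_natCast, smul_eq_mul,
      pow_one, pow_zero, nsmul_eq_mul, mul_one]
    push_cast
    have : ((n : ℝ) + 1) ≠ 0 := by positivity
    field_simp

lemma abs_diffCoeff (α : ℝ) (n : ℕ) : |diffCoeff α n| = |fracBinom α n| := by
  simp [diffCoeff, abs_mul]

lemma summable_abs_diffCoeff {α : ℝ} (hα : 0 < α) : Summable fun ν => |diffCoeff α ν| := by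
  obtain ⟨n₀, hn₀⟩ := exists_nat_ge α
  have hrec : ∀ ν : ℕ, n₀ ≤ ν →
      α * |diffCoeff α ν| = ν * |diffCoeff α ν| - (ν + 1 : ℕ) * |diffCoeff α (ν + 1)| := by
    intro ν hν
    have h1 : α ≤ ν := hn₀.trans (by exact_mod_cast hν)
    have h2 : (0:ℝ) < (ν : ℝ) + 1 := by positivity
    rw [abs_diffCoeff, abs_diffCoeff, fracBinom, abs_div, abs_mul, abs_of_pos h2,
      abs_of_nonpos (sub_nonpos.2 h1)]
    push_cast
    field_simp
    ring
  rw [← summable_nat_add_iff n₀]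
  refine summable_of_sum_range_le (c := n₀ * |diffCoeff α n₀| / α) (fun _ => abs_nonneg _)
    fun n => ?_
  rw [le_div_iff₀ hα, mul_comm, Finset.mul_sum]
  have : ∀ i ∈ Finset.range n, α * |diffCoeff α (i + n₀)|
      = ((i + n₀ : ℕ) : ℝ) * |diffCoeff α (i + n₀)|
        - ((i + 1 + n₀ : ℕ) : ℝ) * |diffCoeff α (i + 1 + n₀)| := by
    intro i _
    rw [hrec _ (by omega), show i + n₀ + 1 = i + 1 + n₀ by omega]
  rw [Finset.sum_congr rfl this,
    Finset.sum_range_sub' (fun i => ((i + n₀ : ℕ) : ℝ) * |diffCoeff α (i + n₀)|) n, zero_add]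
  have : 0 ≤ ((n + n₀ : ℕ) : ℝ) * |diffCoeff α (n + n₀)| := by positivity
  linarith

/-- The symbol of the fractional difference. -/
def diffSymbol (α : ℝ) (z : ℂ) : ℂ := ∑' ν : ℕ, (diffCoeff α ν : ℂ) * z ^ ν

lemma summable_diffSymbol {α : ℝ} (hα : 0 < α) {z : ℂ} (hz : ‖z‖ ≤ 1) :
    Summable fun ν : ℕ => (diffCoeff α ν : ℂ) * z ^ ν := by
  refine Summable.of_norm_bounded (summable_abs_diffCoeff hα) fun ν => ?_
  rw [norm_mul, norm_pow, Complex.norm_real, Real.norm_eq_abs]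
  exact mul_le_of_le_one_right (abs_nonneg _) (pow_le_one₀ (norm_nonneg _) hz)

lemma norm_diffSymbol {α : ℝ} (hα : 0 < α) {z : ℂ} (hz : ‖z‖ ≤ 1) :
    ‖diffSymbol α z‖ = ‖1 - z‖ ^ α := by
  have hball : Set.EqOn (fun z => ‖diffSymbol α z‖) (fun z => ‖1 - z‖ ^ α)
      (Metric.ball (0:ℂ) 1) := by
    intro z hz
    have hz' : ‖z‖ < 1 := by simpa using hz
    have h := (Complex.one_add_cpow_hasFPowerSeriesOnBall_zero (a := (α : ℂ))).hasSum
      (y := -z) (by simpa [enorm_eq_nnnorm, ← NNReal.coe_lt_coe] using hz')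
    have h2 : diffSymbol α z = (1 - z) ^ (α : ℂ) := by
      rw [diffSymbol, sub_eq_add_neg]
      have h3 := h.tsum_eq
      rw [zero_add] at h3
      rw [← h3]
      refine tsum_congr fun ν => ?_
      rw [binomialSeries_apply, ← Complex.ofReal_choose, ← fracBinom_eq_choose]
      simp only [diffCoeff, List.ofFn_const, List.prod_replicate, smul_eq_mul, neg_pow z]
      push_cast
      ring
    simp only [h2, Complex.norm_cpow_real]
  refine hball.of_subset_closure (t := Metric.closedBall 0 1) ?_ ?_ Metric.ball_subset_closedBall
    (closure_ball (0:ℂ) one_ne_zero).ge (by simpa using hz)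
  · refine ContinuousOn.norm ?_
    refine continuousOn_tsum (fun ν => by fun_prop) (summable_abs_diffCoeff hα) fun ν z hz => ?_
    rw [norm_mul, norm_pow, Complex.norm_real, Real.norm_eq_abs]
    exact mul_le_of_le_one_right (abs_nonneg _) (pow_le_one₀ (norm_nonneg _) (by simpa using hz))
  · exact Continuous.continuousOn
      (Continuous.rpow_const (by fun_prop) fun _ => Or.inr hα.le)

/-- Modulus of the symbol of the fractional difference at the frequency `k`. -/
def diffGain (α h k : ℝ) : ℝ := |2 * Real.sin (k * h / 2)| ^ α

/-- The fractional difference multiplies a cosine wave by its gain and shifts its phase. -/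
lemma exists_diffPhase {α : ℝ} (hα : 0 < α) (h k : ℝ) : ∃ ξ : ℝ, ∀ x : ℝ,
    ∑' ν : ℕ, diffCoeff α ν * Real.cos (k * (x + (α - (ν : ℝ)) * h))
      = diffGain α h k * Real.cos (k * x + ξ) := by
  set z : ℂ := Complex.exp (Complex.I * ((-(k * h) : ℝ) : ℂ)) with hzdef
  have hz : ‖z‖ = 1 := by
    rw [hzdef, mul_comm]; exact Complex.norm_exp_ofReal_mul_I _
  set m : ℂ := Complex.exp (((k * α * h : ℝ) : ℂ) * Complex.I) * diffSymbol α z with hm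
  have hnorm : ‖m‖ = diffGain α h k := by
    rw [hm, norm_mul, Complex.norm_exp_ofReal_mul_I, one_mul, norm_diffSymbol hα hz.le, diffGain,
      norm_sub_rev, hzdef, Complex.norm_exp_I_mul_ofReal_sub_one, Real.norm_eq_abs, neg_div,
      Real.sin_neg, mul_neg, abs_neg]
  refine ⟨Complex.arg m, fun x => ?_⟩
  have hs := (summable_diffSymbol hα hz.le).hasSum.mul_left
    (Complex.exp (((k * x + k * α * h : ℝ) : ℂ) * Complex.I))
  have hre := Complex.hasSum_re hs
  have hterm : ∀ ν : ℕ, (Complex.exp (((k * x + k * α * h : ℝ) : ℂ) * Complex.I) *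
      ((diffCoeff α ν : ℂ) * z ^ ν)).re
        = diffCoeff α ν * Real.cos (k * (x + (α - (ν : ℝ)) * h)) := by
    intro ν
    have : Complex.exp (((k * x + k * α * h : ℝ) : ℂ) * Complex.I) * ((diffCoeff α ν : ℂ) * z ^ ν)
        = (diffCoeff α ν : ℂ) *
          Complex.exp (((k * (x + (α - (ν : ℝ)) * h) : ℝ) : ℂ) * Complex.I) := by
      rw [hzdef, ← Complex.exp_nat_mul, mul_left_comm, ← Complex.exp_add]
      congr 2
      push_cast
      ring
    rw [this, Complex.re_ofReal_mul, Complex.exp_ofReal_mul_I_re]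
  simp only [hterm] at hre
  rw [hre.tsum_eq]
  change (Complex.exp (((k * x + k * α * h : ℝ) : ℂ) * Complex.I) * diffSymbol α z).re = _
  have : Complex.exp (((k * x + k * α * h : ℝ) : ℂ) * Complex.I) * diffSymbol α z
      = (diffGain α h k : ℂ) * Complex.exp (((k * x + Complex.arg m : ℝ) : ℂ) * Complex.I) := by
    calc _ = Complex.exp (((k * x : ℝ) : ℂ) * Complex.I) * m := by
          rw [hm, ← mul_assoc, ← Complex.exp_add]
          congr 2
          push_cast
          ring
      _ = _ := by
          conv_lhs => rw [← Complex.norm_mul_exp_arg_mul_I m, hnorm]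
          rw [mul_left_comm, ← Complex.exp_add]
          congr 2
          push_cast
          ring
  rw [this, Complex.re_ofReal_mul, Complex.exp_ofReal_mul_I_re]

lemma diffGain_nonneg (α h k : ℝ) : 0 ≤ diffGain α h k := by unfold diffGain; positivity

/-- Weight with which the frequency `2^μ` enters the modulus of order `α` at step `2^{-n}`. -/
def modWeight (α : ℝ) (n μ : ℕ) : ℝ := if μ ≤ n then (2:ℝ) ^ (α * ((μ:ℝ) - n)) else 1

lemma modWeight_pos (α : ℝ) (n μ : ℕ) : 0 < modWeight α n μ := by
  unfold modWeight; split_ifs <;> positivity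

lemma modWeight_of_le (α : ℝ) {n μ : ℕ} (h : μ ≤ n) :
    modWeight α n μ = ((2:ℝ) ^ μ * ((2:ℝ) ^ n)⁻¹) ^ α := by
  rw [modWeight, if_pos h, mul_comm α, Real.rpow_mul (by norm_num), Real.rpow_sub (by norm_num),
    Real.rpow_natCast, Real.rpow_natCast, div_eq_mul_inv]

lemma diffGain_le {α : ℝ} (hα : 0 < α) {n : ℕ} {h : ℝ} (hh : |h| ≤ ((2:ℝ)^n)⁻¹) (μ : ℕ) :
    diffGain α h (2 ^ μ) ≤ 2 ^ α * modWeight α n μ := by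
  rw [diffGain]
  by_cases hμ : μ ≤ n
  · rw [modWeight_of_le α hμ, ← Real.mul_rpow (by positivity) (by positivity)]
    refine Real.rpow_le_rpow (abs_nonneg _) ?_ hα.le
    have h1 : |Real.sin (2 ^ μ * h / 2)| ≤ |2 ^ μ * h / 2| := Real.abs_sin_le_abs
    have h2 : |2 ^ μ * h / 2| = 2 ^ μ * |h| / 2 := by
      rw [abs_div, abs_mul, abs_of_pos (by positivity : (0:ℝ) < 2 ^ μ), abs_two]
    have h3 : (2:ℝ) ^ μ * |h| ≤ 2 ^ μ * ((2:ℝ)^n)⁻¹ := by gcongr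
    have h4 : (0:ℝ) ≤ 2 ^ μ * ((2:ℝ)^n)⁻¹ := by positivity
    rw [abs_mul, abs_two]
    linarith
  · rw [modWeight, if_neg hμ, mul_one]
    refine Real.rpow_le_rpow (abs_nonneg _) ?_ hα.le
    rw [abs_mul, abs_two]
    have := Real.abs_sin_le_one (2 ^ μ * h / 2)
    linarith

lemma sin_sq_two_pow_mul_pi_div_three (k : ℕ) : Real.sin (2 ^ k * (π / 3)) ^ 2 = 3 / 4 := by
  induction k with
  | zero => rw [pow_zero, one_mul, Real.sq_sin_pi_div_three]
  | succ k ih =>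
    rw [show (2:ℝ) ^ (k + 1) * (π / 3) = 2 * (2 ^ k * (π / 3)) by ring, Real.sin_two_mul, mul_pow,
      mul_pow, Real.cos_sq', ih]
    norm_num

lemma one_half_le_abs_sin (k : ℕ) : 1 / 2 ≤ |Real.sin (2 ^ k * (π / 6))| := by
  cases k with
  | zero => rw [pow_zero, one_mul, Real.sin_pi_div_six]; norm_num
  | succ k =>
    have h := sin_sq_two_pow_mul_pi_div_three k
    rw [show (2:ℝ) ^ (k + 1) * (π / 6) = 2 ^ k * (π / 3) by ring]
    refine abs_le_of_sq_le_sq' ?_ (abs_nonneg _) |>.2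
    rw [sq_abs, h]
    norm_num

lemma le_diffGain {α : ℝ} (hα : 0 < α) (n μ : ℕ) :
    (1 / 3) ^ α * modWeight α n μ ≤ diffGain α (((2:ℝ)^n)⁻¹ * (π / 6)) (2 ^ μ) := by
  rw [diffGain]
  by_cases hμ : μ ≤ n
  · rw [modWeight_of_le α hμ, ← Real.mul_rpow (by positivity) (by positivity)]
    refine Real.rpow_le_rpow (by positivity) ?_ hα.le
    set q : ℝ := 2 ^ μ * ((2:ℝ)^n)⁻¹ with hq
    have hq0 : 0 ≤ q := by positivity
    have hq1 : q ≤ 1 := by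
      rw [hq, mul_inv_le_iff₀ (by positivity), one_mul]
      exact pow_le_pow_right₀ (by norm_num) hμ
    have h1 := Real.mul_le_sin (x := q * (π / 12)) (by positivity) (by
      nlinarith [Real.pi_pos])
    have h2 : (2:ℝ) ^ μ * (((2:ℝ)^n)⁻¹ * (π / 6)) / 2 = q * (π / 12) := by rw [hq]; ring
    have h3 : 2 / π * (q * (π / 12)) = q / 6 := by field_simp; ring
    rw [h2]
    rw [h3] at h1
    calc 1 / 3 * q ≤ 2 * Real.sin (q * (π / 12)) := by linarith
      _ ≤ _ := le_abs_self _
  · obtain ⟨k, rfl⟩ := Nat.exists_eq_add_of_lt (not_le.1 hμ)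
    rw [modWeight, if_neg hμ, mul_one]
    refine Real.rpow_le_rpow (by positivity) ?_ hα.le
    have h2 : (2:ℝ) ^ (n + k + 1) * (((2:ℝ)^n)⁻¹ * (π / 6)) / 2 = 2 ^ k * (π / 6) := by
      rw [pow_succ, pow_add]; field_simp
    rw [h2, abs_mul, abs_two]
    linarith [one_half_le_abs_sin k]

/-- Lebesgue measure on one period. -/
def periodMeasure : Measure ℝ := volume.restrict (Set.Ioc (0:ℝ) (2*π))

instance : IsFiniteMeasure periodMeasure := by
  unfold periodMeasure; infer_instance

lemma intervalIntegral_eq_periodMeasure (g : ℝ → ℝ) :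
    ∫ x in (0:ℝ)..(2*π), g x = ∫ x, g x ∂periodMeasure := by
  rw [intervalIntegral.integral_of_le (by positivity), periodMeasure]

/-- An integrable function on the circle with vanishing Fourier coefficients is zero. -/
lemma ae_eq_zero_of_integral_mul_fourier {T : ℝ} [hT : Fact (0 < T)] {G : AddCircle T → ℂ}
    (hG : Integrable G) (h0 : ∀ n : ℤ, ∫ t, G t * fourier n t = 0) : G =ᵐ[volume] 0 := by
  have hint : ∀ φ : C(AddCircle T, ℂ), Integrable fun t => G t * φ t := fun φ =>
    hG.mul_bdd (c := ‖φ‖) φ.continuous.aestronglyMeasurable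
      (Filter.Eventually.of_forall fun t => φ.norm_coe_le_norm t)
  let Λ : C(AddCircle T, ℂ) →L[ℂ] ℂ := LinearMap.mkContinuous
    { toFun := fun φ => ∫ t, G t * φ t
      map_add' := fun φ ψ => by
        simp only [ContinuousMap.add_apply, mul_add]
        exact integral_add (hint φ) (hint ψ)
      map_smul' := fun c φ => by
        simp only [ContinuousMap.smul_apply, smul_eq_mul, RingHom.id_apply, mul_left_comm]
        exact integral_const_mul _ _ } (∫ t, ‖G t‖) (fun φ => by
      change ‖∫ t, G t * φ t‖ ≤ _
      refine (norm_integral_le_integral_norm _).trans ?_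
      rw [← integral_mul_const]
      refine integral_mono (hint φ).norm (hG.norm.mul_const _) fun t => ?_
      simp only [norm_mul]
      gcongr
      exact φ.norm_coe_le_norm t)
  have hΛ : ∀ φ, Λ φ = 0 := by
    have hle : Submodule.span ℂ (Set.range (fourier (T := T))) ≤ Λ.toLinearMap.ker := by
      rw [Submodule.span_le]
      rintro _ ⟨n, rfl⟩
      exact h0 n
    have hcl := Submodule.topologicalClosure_minimal _ hle Λ.isClosed_ker
    rw [span_fourier_closure_eq_top] at hcl
    exact fun φ => hcl (Submodule.mem_top (x := φ))
  refine ae_eq_zero_of_forall_setIntegral_isClosed_eq_zero hG fun s hs => ?_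
  rw [← integral_indicator hs.measurableSet]
  have hδ : ∀ n : ℕ, (0:ℝ) < 1 / ((n:ℝ) + 1) := fun n => by positivity
  have hlim :=
    thickenedIndicator_tendsto_indicator_closure hδ tendsto_one_div_add_atTop_nhds_zero_nat s
  rw [tendsto_pi_nhds, hs.closure_eq] at hlim
  have hten : Filter.Tendsto (fun n : ℕ => ∫ t, G t * ((thickenedIndicator (hδ n) s t : ℝ) : ℂ))
      Filter.atTop (nhds (∫ t, s.indicator G t)) := by
    refine tendsto_integral_of_dominated_convergence (fun t => ‖G t‖) ?_ hG.norm ?_ ?_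
    · intro n
      exact hG.aestronglyMeasurable.mul (Continuous.aestronglyMeasurable (by fun_prop))
    · refine fun n => Filter.Eventually.of_forall fun t => ?_
      rw [norm_mul]
      refine mul_le_of_le_one_right (norm_nonneg _) ?_
      simpa using thickenedIndicator_le_one (hδ n) s t
    · refine Filter.Eventually.of_forall fun t => ?_
      have h1 := hlim t
      have h2 : Filter.Tendsto (fun n : ℕ => ((thickenedIndicator (hδ n) s t : ℝ) : ℂ))
          Filter.atTop (nhds (((s.indicator (fun _ => (1 : NNReal)) t : NNReal) : ℝ) : ℂ)) :=
        (Complex.continuous_ofReal.tendsto _).comp ((NNReal.continuous_coe.tendsto _).comp h1)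
      have h3 := h2.const_mul (G t)
      convert h3 using 2
      by_cases ht : t ∈ s <;> simp [ht]
  have hzero : ∀ n : ℕ, ∫ t, G t * ((thickenedIndicator (hδ n) s t : ℝ) : ℂ) = 0 := fun n =>
    hΛ ⟨fun t => ((thickenedIndicator (hδ n) s t : ℝ) : ℂ), by fun_prop⟩
  simp only [hzero] at hten
  exact tendsto_nhds_unique hten tendsto_const_nhds

instance : Fact (0 < 2 * π) := ⟨by positivity⟩

/-- An integrable function on a period all of whose trigonometric moments vanish is zero. -/
lemma ae_eq_zero_of_integral_mul_cos_sin {g : ℝ → ℝ} (hg : Integrable g periodMeasure)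
    (hcos : ∀ n : ℕ, ∫ x, g x * Real.cos (n * x) ∂periodMeasure = 0)
    (hsin : ∀ n : ℕ, ∫ x, g x * Real.sin (n * x) ∂periodMeasure = 0) :
    g =ᵐ[periodMeasure] 0 := by
  have hmp := AddCircle.measurePreserving_mk (2 * π) 0
  rw [zero_add] at hmp
  set G : AddCircle (2 * π) → ℂ := AddCircle.liftIoc (2 * π) 0 (fun x => (g x : ℂ)) with hGdef
  have hGg : ∀ x ∈ Set.Ioc 0 (2 * π), G x = g x := fun x hx =>
    AddCircle.liftIoc_coe_apply (by simpa using hx)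
  have hG : Integrable G := by
    rw [← memLp_one_iff_integrable]
    refine MeasureTheory.MemLp.memLp_liftIoc ?_
    rw [zero_add, memLp_one_iff_integrable]
    exact hg.ofReal
  have h0 : ∀ n : ℤ, ∫ t, G t * fourier n t = 0 := by
    intro n
    rw [← AddCircle.integral_preimage (2 * π) 0, zero_add]
    have h1 : ∫ x in Set.Ioc 0 (2 * π), G x * fourier n (x : AddCircle (2 * π))
        = ∫ x in Set.Ioc 0 (2 * π),
          (((g x * Real.cos (n * x) : ℝ) : ℂ)
            + ((g x * Real.sin (n * x) : ℝ) : ℂ) * Complex.I) := by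
      refine setIntegral_congr_fun measurableSet_Ioc fun x hx => ?_
      rw [hGg x hx, fourier_coe_apply]
      have : 2 * (π : ℂ) * Complex.I * n * x / ((2 * π : ℝ) : ℂ)
          = ((n * x : ℝ) : ℂ) * Complex.I := by
        push_cast
        have : (π : ℂ) ≠ 0 := by exact_mod_cast Real.pi_ne_zero
        field_simp
      rw [this, Complex.exp_mul_I, ← Complex.ofReal_cos, ← Complex.ofReal_sin]
      push_cast
      ring
    have hc : ∀ n : ℤ, ∫ x, g x * Real.cos (n * x) ∂periodMeasure = 0 := by
      intro n
      obtain ⟨k, rfl | rfl⟩ := n.eq_nat_or_neg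
      · exact_mod_cast hcos k
      · have := hcos k
        simpa [Real.cos_neg] using this
    have hs : ∀ n : ℤ, ∫ x, g x * Real.sin (n * x) ∂periodMeasure = 0 := by
      intro n
      obtain ⟨k, rfl | rfl⟩ := n.eq_nat_or_neg
      · exact_mod_cast hsin k
      · have := hsin k
        simpa [Real.sin_neg, integral_neg] using this
    have hic : Integrable (fun x => g x * Real.cos (n * x)) periodMeasure :=
      hg.mul_bdd (c := 1) (Continuous.aestronglyMeasurable (by fun_prop))
        (Filter.Eventually.of_forall fun x => Real.abs_cos_le_one _)
    have his : Integrable (fun x => g x * Real.sin (n * x)) periodMeasure :=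
      hg.mul_bdd (c := 1) (Continuous.aestronglyMeasurable (by fun_prop))
        (Filter.Eventually.of_forall fun x => Real.abs_sin_le_one _)
    rw [h1, ← periodMeasure, integral_add hic.ofReal (his.ofReal.mul_const _), integral_mul_const,
      integral_complex_ofReal, integral_complex_ofReal, hc, hs]
    simp
  have hae := hmp.quasiMeasurePreserving.ae (ae_eq_zero_of_integral_mul_fourier hG h0)
  filter_upwards [hae, ae_restrict_mem measurableSet_Ioc] with x hx hmem
  rw [hGg x hmem] at hx
  simpa using hx

/-- Lebesgue measure on the period square. -/
def squareMeasure : Measure (ℝ × ℝ) := periodMeasure.prod periodMeasure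

instance : IsFiniteMeasure squareMeasure := by
  unfold squareMeasure; infer_instance

/-- A trigonometric test function with frequencies `m, n` and phases `c, c'`. -/
def trigTest (m n : ℕ) (c c' : ℝ) (z : ℝ × ℝ) : ℝ :=
  Real.cos (m * z.1 + c) * Real.cos (n * z.2 + c')

lemma continuous_trigTest (m n : ℕ) (c c' : ℝ) : Continuous (trigTest m n c c') := by
  unfold trigTest; fun_prop

lemma abs_trigTest_le_one (m n : ℕ) (c c' : ℝ) (z : ℝ × ℝ) : |trigTest m n c c' z| ≤ 1 := by
  rw [trigTest, abs_mul]
  exact mul_le_one₀ (Real.abs_cos_le_one _) (abs_nonneg _) (Real.abs_cos_le_one _)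

lemma MeasureTheory.Integrable.mul_trigTest {H : ℝ × ℝ → ℝ} (hH : Integrable H squareMeasure)
    (m n : ℕ) (c c' : ℝ) : Integrable (fun z => H z * trigTest m n c c' z) squareMeasure :=
  hH.mul_bdd (c := 1) (continuous_trigTest m n c c').aestronglyMeasurable
    (Filter.Eventually.of_forall fun z => abs_trigTest_le_one m n c c' z)

lemma integral_mul_cos_mul_cos_eq (H : ℝ × ℝ → ℝ) (hH : Integrable H squareMeasure)
    (m n : ℕ) (c c' : ℝ) :
    ∫ z, H z * trigTest m n c c' z ∂squareMeasure
      = ∫ x, (∫ y, H (x, y) * Real.cos (n * y + c') ∂periodMeasure) * Real.cos (m * x + c)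
          ∂periodMeasure := by
  rw [squareMeasure, integral_prod _ (hH.mul_trigTest m n c c')]
  refine integral_congr_ae (Filter.Eventually.of_forall fun x => ?_)
  simp only [trigTest]
  rw [← integral_mul_const]
  congr 1
  ext y
  ring

/-- An integrable function on the period square all of whose trigonometric moments vanish
is zero. -/
lemma ae_eq_zero_of_integral_mul_trigTest {H : ℝ × ℝ → ℝ} (hH : Integrable H squareMeasure)
    (h0 : ∀ m n c c', ∫ z, H z * trigTest m n c c' z ∂squareMeasure = 0) :
    H =ᵐ[squareMeasure] 0 := by
  have hsin : ∀ t : ℝ, Real.cos (t + -(π / 2)) = Real.sin t := fun t => by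
    rw [← sub_eq_add_neg, Real.cos_sub_pi_div_two]
  have hA : ∀ (n : ℕ) (c' : ℝ),
      ∀ᵐ x ∂periodMeasure, ∫ y, H (x, y) * Real.cos (n * y + c') ∂periodMeasure = 0 := by
    intro n c'
    have hint : Integrable (fun z : ℝ × ℝ => H z * Real.cos (n * z.2 + c')) squareMeasure :=
      hH.mul_bdd (c := 1) (Continuous.aestronglyMeasurable (by fun_prop))
        (Filter.Eventually.of_forall fun z => Real.abs_cos_le_one _)
    refine ae_eq_zero_of_integral_mul_cos_sin hint.integral_prod_left ?_ ?_
    · intro m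
      have := h0 m n 0 c'
      rw [integral_mul_cos_mul_cos_eq H hH] at this
      simpa using this
    · intro m
      have := h0 m n (-(π / 2)) c'
      rw [integral_mul_cos_mul_cos_eq H hH] at this
      simpa only [hsin] using this
  have hslice : ∀ᵐ x ∂periodMeasure, ∫ y, ‖H (x, y)‖ ∂periodMeasure = 0 := by
    filter_upwards [hH.prod_right_ae, ae_all_iff.2 fun n => hA n 0,
      ae_all_iff.2 fun n => hA n (-(π / 2))] with x hx h1 h2
    have : (fun y => H (x, y)) =ᵐ[periodMeasure] 0 := by
      refine ae_eq_zero_of_integral_mul_cos_sin hx ?_ ?_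
      · simpa using h1
      · simpa only [hsin] using h2
    refine integral_eq_zero_of_ae ?_
    filter_upwards [this] with y hy
    simp only [hy, Pi.zero_apply, norm_zero]
  have hnorm : ∫ z, ‖H z‖ ∂squareMeasure = 0 := by
    rw [squareMeasure, integral_prod _ hH.norm]
    exact integral_eq_zero_of_ae hslice
  rw [integral_eq_zero_iff_of_nonneg (fun z => norm_nonneg _) hH.norm] at hnorm
  filter_upwards [hnorm] with z hz
  simpa using hz

lemma integral_cos_int_mul_add {k : ℤ} (hk : k ≠ 0) (c : ℝ) :
    ∫ x in (0:ℝ)..(2*π), Real.cos (k * x + c) = 0 := by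
  have hk' : (k : ℝ) ≠ 0 := by exact_mod_cast hk
  rw [intervalIntegral.integral_comp_mul_add (f := Real.cos) hk' c, integral_cos]
  have h : (k : ℝ) * (2 * π) + c = c + k * (2 * π) := by ring
  rw [h, Real.sin_add_int_mul_two_pi]
  simp

lemma integral_cos_mul_cos (m n : ℕ) (hn : n ≠ 0) (c c' : ℝ) :
    ∫ x, Real.cos (m * x + c) * Real.cos (n * x + c') ∂periodMeasure
      = if m = n then π * Real.cos (c - c') else 0 := by
  rw [← intervalIntegral_eq_periodMeasure]
  have h : ∀ x : ℝ, Real.cos (m * x + c) * Real.cos (n * x + c')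
      = 1 / 2 * Real.cos (((m - n : ℤ) : ℝ) * x + (c - c'))
        + 1 / 2 * Real.cos (((m + n : ℤ) : ℝ) * x + (c + c')) := by
    intro x
    have h1 : (((m - n : ℤ) : ℝ)) * x + (c - c') = (m * x + c) - (n * x + c') := by
      push_cast; ring
    have h2 : (((m + n : ℤ) : ℝ)) * x + (c + c') = (m * x + c) + (n * x + c') := by
      push_cast; ring
    rw [h1, h2, Real.cos_sub (m * x + c), Real.cos_add (m * x + c)]
    ring
  simp only [h]
  rw [intervalIntegral.integral_add (Continuous.intervalIntegrable (by fun_prop) _ _)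
    (Continuous.intervalIntegrable (by fun_prop) _ _), intervalIntegral.integral_const_mul,
    intervalIntegral.integral_const_mul, integral_cos_int_mul_add (k := (m + n : ℤ)) (by omega)]
  split_ifs with hmn
  · subst hmn
    simp
    ring
  · rw [integral_cos_int_mul_add (k := (m - n : ℤ)) (by omega)]
    simp

/-- A lacunary trigonometric polynomial with given coefficients and phases. -/
def dyadicPoly (θ η : ℕ → ℝ) (d : ℕ → ℕ → ℝ) (N : ℕ) (z : ℝ × ℝ) : ℝ :=
  ∑ i ∈ Finset.range N, ∑ j ∈ Finset.range N, d i j * dyadicWave θ i z.1 * dyadicWave η j z.2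

/-- The `ℓ²` norm of the first coefficients of a double sequence. -/
def coeffNorm (d : ℕ → ℕ → ℝ) (N : ℕ) : ℝ :=
  √(∑ i ∈ Finset.range N, ∑ j ∈ Finset.range N, d i j ^ 2)

lemma coeffNorm_sq (d : ℕ → ℕ → ℝ) (N : ℕ) :
    coeffNorm d N ^ 2 = ∑ i ∈ Finset.range N, ∑ j ∈ Finset.range N, d i j ^ 2 :=
  Real.sq_sqrt (Finset.sum_nonneg fun _ _ => Finset.sum_nonneg fun _ _ => sq_nonneg _)

lemma coeffNorm_nonneg (d : ℕ → ℕ → ℝ) (N : ℕ) : 0 ≤ coeffNorm d N := Real.sqrt_nonneg _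

lemma dyadicPoly_eq_trigTest (θ η : ℕ → ℝ) (d : ℕ → ℕ → ℝ) (N : ℕ) (z : ℝ × ℝ) :
    dyadicPoly θ η d N z = ∑ i ∈ Finset.range N, ∑ j ∈ Finset.range N,
      d i j * trigTest (2 ^ i) (2 ^ j) (θ i) (η j) z := by
  simp [dyadicPoly, trigTest, dyadicWave, mul_assoc]

lemma continuous_dyadicPoly (θ η : ℕ → ℝ) (d : ℕ → ℕ → ℝ) (N : ℕ) :
    Continuous (dyadicPoly θ η d N) := by
  simp only [funext (dyadicPoly_eq_trigTest θ η d N)]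
  have := continuous_trigTest
  fun_prop

lemma abs_dyadicPoly_le (θ η : ℕ → ℝ) (d : ℕ → ℕ → ℝ) (N : ℕ) (z : ℝ × ℝ) :
    |dyadicPoly θ η d N z| ≤ ∑ i ∈ Finset.range N, ∑ j ∈ Finset.range N, |d i j| := by
  rw [dyadicPoly_eq_trigTest]
  refine (Finset.abs_sum_le_sum_abs _ _).trans (Finset.sum_le_sum fun i _ => ?_)
  refine (Finset.abs_sum_le_sum_abs _ _).trans (Finset.sum_le_sum fun j _ => ?_)
  rw [abs_mul]
  exact mul_le_of_le_one_right (abs_nonneg _) (abs_trigTest_le_one _ _ _ _ _)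

lemma memLp_dyadicPoly (θ η : ℕ → ℝ) (d : ℕ → ℕ → ℝ) (N : ℕ) (q : ℝ≥0∞) :
    MemLp (dyadicPoly θ η d N) q squareMeasure :=
  MemLp.of_bound (continuous_dyadicPoly θ η d N).aestronglyMeasurable _
    (Filter.Eventually.of_forall fun z => abs_dyadicPoly_le θ η d N z)

lemma integral_trigTest_mul_trigTest (m n k l : ℕ) (hk : k ≠ 0) (hl : l ≠ 0) (a b c c' : ℝ) :
    ∫ z, trigTest m n c c' z * trigTest k l a b z ∂squareMeasure
      = (if m = k then π * Real.cos (c - a) else 0)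
        * (if n = l then π * Real.cos (c' - b) else 0) := by
  rw [← integral_cos_mul_cos m k hk, ← integral_cos_mul_cos n l hl, squareMeasure,
    ← integral_prod_mul]
  congr 1
  ext z
  simp only [trigTest]
  ring

lemma integrable_trigTest (m n : ℕ) (c c' : ℝ) : Integrable (trigTest m n c c') squareMeasure :=
  Integrable.of_bound (continuous_trigTest m n c c').aestronglyMeasurable 1
    (Filter.Eventually.of_forall fun z => abs_trigTest_le_one m n c c' z)

lemma integral_mul_dyadicPoly {H : ℝ × ℝ → ℝ} (hH : Integrable H squareMeasure)
    (θ η : ℕ → ℝ) (d : ℕ → ℕ → ℝ) (N : ℕ) :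
    ∫ z, H z * dyadicPoly θ η d N z ∂squareMeasure
      = ∑ i ∈ Finset.range N, ∑ j ∈ Finset.range N,
        d i j * ∫ z, H z * trigTest (2 ^ i) (2 ^ j) (θ i) (η j) z ∂squareMeasure := by
  simp only [dyadicPoly_eq_trigTest, Finset.mul_sum, mul_left_comm (H _)]
  have hi : ∀ i j, Integrable (fun z => d i j *
      (H z * trigTest (2 ^ i) (2 ^ j) (θ i) (η j) z)) squareMeasure := fun i j =>
    (hH.mul_trigTest _ _ _ _).const_mul _
  rw [integral_finsetSum _ fun i _ => integrable_finsetSum _ fun j _ => hi i j]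
  refine Finset.sum_congr rfl fun i _ => ?_
  rw [integral_finsetSum _ fun j _ => hi i j]
  refine Finset.sum_congr rfl fun j _ => ?_
  rw [integral_const_mul]

lemma integral_trigTest_mul_dyadicPoly (θ η : ℕ → ℝ) (d : ℕ → ℕ → ℝ) (N m n : ℕ) (c c' : ℝ) :
    ∫ z, trigTest m n c c' z * dyadicPoly θ η d N z ∂squareMeasure
      = ∑ i ∈ Finset.range N, ∑ j ∈ Finset.range N,
        d i j * ((if m = 2 ^ i then π * Real.cos (c - θ i) else 0)
          * (if n = 2 ^ j then π * Real.cos (c' - η j) else 0)) := by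
  rw [integral_mul_dyadicPoly (integrable_trigTest m n c c')]
  simp only [integral_trigTest_mul_trigTest m n _ _ (pow_ne_zero _ two_ne_zero)
    (pow_ne_zero _ two_ne_zero)]

lemma integral_dyadicPoly_sq (θ η : ℕ → ℝ) (d : ℕ → ℕ → ℝ) (N : ℕ) :
    ∫ z, dyadicPoly θ η d N z * dyadicPoly θ η d N z ∂squareMeasure
      = π ^ 2 * coeffNorm d N ^ 2 := by
  rw [integral_mul_dyadicPoly ((memLp_dyadicPoly θ η d N 1).integrable le_rfl), coeffNorm_sq,
    Finset.mul_sum]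
  refine Finset.sum_congr rfl fun i hi => ?_
  rw [Finset.mul_sum]
  refine Finset.sum_congr rfl fun j hj => ?_
  simp only [mul_comm (dyadicPoly θ η d N _)]
  rw [integral_trigTest_mul_dyadicPoly]
  have hinj : ∀ a b : ℕ, (2 ^ a = 2 ^ b) = (a = b) := fun a b => by
    simp
  simp only [hinj]
  rw [Finset.sum_eq_single i (by intro b _ hb; simp [hb.symm]) (by simp [hi]),
    Finset.sum_eq_single j (by intro b _ hb; simp [hb.symm]) (by simp [hj])]
  simp
  ring

/-- Upper Khinchin inequality for double lacunary polynomials. -/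
lemma exists_eLpNorm_dyadicPoly_le (q : ℝ) :
    ∃ K : ℝ, 0 < K ∧ ∀ θ η d N,
      eLpNorm (dyadicPoly θ η d N) (ENNReal.ofReal q) squareMeasure
        ≤ ENNReal.ofReal (K * coeffNorm d N) := by
  obtain ⟨r, hr⟩ := exists_nat_ge q
  set s : ℝ := 2 * (r + 1) with hs
  have hqs : q ≤ s := by rw [hs]; linarith [r.cast_nonneg (α := ℝ)]
  have hs0 : 0 < s := by positivity
  have huniv : squareMeasure Set.univ ≠ ⊤ := measure_ne_top _ _
  set U : ℝ := (squareMeasure Set.univ ^ (1 / (ENNReal.ofReal q).toReal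
    - 1 / (ENNReal.ofReal s).toReal)).toReal with hU
  set M : ℝ := (dyadicMomentConst (r + 1) ^ 2) ^ s⁻¹ with hM
  have hM0 : 0 ≤ M := by positivity
  have hU0 : 0 ≤ U := ENNReal.toReal_nonneg
  refine ⟨M * U + 1, by positivity, fun θ η d N => ?_⟩
  have hc0 := coeffNorm_nonneg d N
  rcases le_or_gt q 0 with hq | hq
  · simp [ENNReal.ofReal_of_nonpos hq]
  have hpow : ∀ x : ℝ, ‖x‖ ^ s = x ^ (2 * (r + 1)) := fun x => by
    rw [hs, show (2 * ((r:ℝ) + 1)) = ((2 * (r + 1) : ℕ) : ℝ) by push_cast; ring, Real.rpow_natCast,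
      Real.norm_eq_abs, (even_two_mul _).pow_abs]
  have h1 : eLpNorm (dyadicPoly θ η d N) (ENNReal.ofReal s) squareMeasure
      ≤ ENNReal.ofReal (M * coeffNorm d N) := by
    rw [(memLp_dyadicPoly θ η d N _).eLpNorm_eq_integral_rpow_norm (by simpa using hs0)
      ENNReal.ofReal_ne_top, ENNReal.toReal_ofReal hs0.le]
    refine ENNReal.ofReal_le_ofReal ?_
    simp only [hpow]
    have hint : Integrable (fun z => dyadicPoly θ η d N z ^ (2 * (r + 1))) squareMeasure := by
      refine Integrable.of_bound
        ((continuous_dyadicPoly θ η d N).pow _).aestronglyMeasurable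
        ((∑ i ∈ Finset.range N, ∑ j ∈ Finset.range N, |d i j|) ^ (2 * (r + 1)))
        (Filter.Eventually.of_forall fun z => ?_)
      rw [norm_pow]
      exact pow_le_pow_left₀ (norm_nonneg _) (abs_dyadicPoly_le θ η d N z) _
    have hmom := integral_integral_dyadicSum_pow_le θ η d N r
    simp only [intervalIntegral_eq_periodMeasure] at hmom
    rw [← coeffNorm_sq] at hmom
    rw [squareMeasure] at hint ⊢
    rw [integral_prod _ hint]
    refine (Real.rpow_le_rpow ?_ hmom (by positivity)).trans (le_of_eq ?_)
    · exact integral_nonneg fun x => integral_nonneg fun y => (even_two_mul _).pow_nonneg _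
    · rw [Real.mul_rpow (by positivity) (by positivity), ← pow_mul]
      congr 1
      rw [← Real.rpow_natCast, ← Real.rpow_mul hc0]
      have : ((2 * (r + 1) : ℕ) : ℝ) * s⁻¹ = 1 := by
        rw [hs]; push_cast; field_simp
      rw [this, Real.rpow_one]
  calc eLpNorm (dyadicPoly θ η d N) (ENNReal.ofReal q) squareMeasure
      ≤ ENNReal.ofReal (M * coeffNorm d N) * ENNReal.ofReal U := by
        refine (eLpNorm_le_eLpNorm_mul_rpow_measure_univ (ENNReal.ofReal_le_ofReal hqs)
          (continuous_dyadicPoly θ η d N).aestronglyMeasurable).trans ?_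
        gcongr
        rw [hU, ENNReal.ofReal_toReal]
        refine ENNReal.rpow_ne_top_of_nonneg ?_ huniv
        rw [ENNReal.toReal_ofReal hq.le, ENNReal.toReal_ofReal hs0.le, sub_nonneg]
        exact one_div_le_one_div_of_le hq hqs
    _ ≤ ENNReal.ofReal ((M * U + 1) * coeffNorm d N) := by
        rw [← ENNReal.ofReal_mul (by positivity)]
        refine ENNReal.ofReal_le_ofReal ?_
        nlinarith

lemma abs_integral_mul_le {p q : ℝ} (hpq : p.HolderConjugate q) {f g : ℝ × ℝ → ℝ}
    (hf : MemLp f (ENNReal.ofReal p) squareMeasure)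
    (hg : MemLp g (ENNReal.ofReal q) squareMeasure) :
    |∫ z, f z * g z ∂squareMeasure|
      ≤ (eLpNorm f (ENNReal.ofReal p) squareMeasure).toReal
        * (eLpNorm g (ENNReal.ofReal q) squareMeasure).toReal := by
  have h := integral_mul_norm_le_Lp_mul_Lq hpq hf hg
  rw [hf.eLpNorm_eq_integral_rpow_norm (by simpa using hpq.pos) ENNReal.ofReal_ne_top,
    hg.eLpNorm_eq_integral_rpow_norm (by simpa using hpq.symm.pos) ENNReal.ofReal_ne_top,
    ENNReal.toReal_ofReal hpq.nonneg, ENNReal.toReal_ofReal hpq.symm.nonneg,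
    ENNReal.toReal_ofReal (by positivity), ENNReal.toReal_ofReal (by positivity),
    ← one_div, ← one_div]
  refine le_trans ?_ h
  rw [← Real.norm_eq_abs]
  simpa only [norm_mul] using
    norm_integral_le_integral_norm (μ := squareMeasure) fun z => f z * g z

/-- Lower Khinchin inequality for double lacunary polynomials. -/
lemma exists_coeffNorm_le {p : ℝ} (hp : 1 < p) :
    ∃ K : ℝ, 0 < K ∧ ∀ θ η d N, ENNReal.ofReal (coeffNorm d N)
      ≤ ENNReal.ofReal K * eLpNorm (dyadicPoly θ η d N) (ENNReal.ofReal p) squareMeasure := by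
  have hpq := Real.HolderConjugate.conjExponent hp
  obtain ⟨K, hK, hle⟩ := exists_eLpNorm_dyadicPoly_le p.conjExponent
  refine ⟨K, hK, fun θ η d N => ?_⟩
  have hc0 := coeffNorm_nonneg d N
  have hm := memLp_dyadicPoly θ η d N
  have h1 := abs_integral_mul_le hpq (hm _) (hm _)
  rw [integral_dyadicPoly_sq, abs_of_nonneg (by positivity)] at h1
  have h2 := ENNReal.toReal_mono ENNReal.ofReal_ne_top (hle θ η d N)
  rw [ENNReal.toReal_ofReal (by positivity)] at h2
  rw [← ENNReal.ofReal_toReal (hm (ENNReal.ofReal p)).eLpNorm_ne_top,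
    ← ENNReal.ofReal_mul hK.le]
  refine ENNReal.ofReal_le_ofReal ?_
  set E := (eLpNorm (dyadicPoly θ η d N) (ENNReal.ofReal p) squareMeasure).toReal
  have hE : 0 ≤ E := ENNReal.toReal_nonneg
  rcases hc0.eq_or_lt with h0 | hpos
  · rw [← h0]; positivity
  refine le_of_mul_le_mul_right ?_ hpos
  calc coeffNorm d N * coeffNorm d N ≤ π ^ 2 * coeffNorm d N ^ 2 := by
        rw [← sq]
        exact le_mul_of_one_le_left (sq_nonneg _) (one_le_pow₀ (by linarith [Real.pi_gt_three]))
    _ ≤ _ := h1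
    _ ≤ E * (K * coeffNorm d N) := by gcongr
    _ = _ := by ring

lemma Lp2Norm_eq_eLpNorm {p : ℝ} (hp : 0 < p) {g : ℝ → ℝ → ℝ}
    (hg : Measurable (Function.uncurry g)) :
    Lp2Norm p g = eLpNorm (Function.uncurry g) (ENNReal.ofReal p) squareMeasure := by
  rw [eLpNorm_eq_lintegral_rpow_enorm_toReal (by simpa using hp) ENNReal.ofReal_ne_top,
    ENNReal.toReal_ofReal hp.le, squareMeasure,
    lintegral_prod _ (hg.enorm.pow_const _).aemeasurable]
  simp only [Lp2Norm, Function.uncurry_apply_pair, periodMeasure, Real.enorm_eq_ofReal_abs,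
    ENNReal.ofReal_rpow_of_nonneg (abs_nonneg _) hp.le]

lemma MemLp0.memLp {p : ℝ} (hp : 0 < p) {f : ℝ → ℝ → ℝ} (hf : MemLp0 p f) :
    MemLp (Function.uncurry f) (ENNReal.ofReal p) squareMeasure :=
  ⟨hf.meas.aestronglyMeasurable, by
    rw [← Lp2Norm_eq_eLpNorm hp hf.meas]; exact hf.norm_ne_top.lt_top⟩

lemma integral_integral_eq_squareMeasure {H : ℝ × ℝ → ℝ} (hH : Integrable H squareMeasure) :
    ∫ x in (0:ℝ)..(2*π), ∫ y in (0:ℝ)..(2*π), H (x, y) = ∫ z, H z ∂squareMeasure := by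
  simp only [intervalIntegral_eq_periodMeasure]
  rw [squareMeasure, integral_prod _ hH]

/-- The trigonometric moments of a function of class `Λ_p`. -/
lemma InLambdaClass.integral_mul_trigTest {p : ℝ} {f : ℝ → ℝ → ℝ} {lam : ℕ → ℕ → ℝ}
    (hp : 1 < p) (h : InLambdaClass p f lam) (m n : ℕ) (c c' : ℝ) :
    ∫ z, Function.uncurry f z * trigTest m n c c' z ∂squareMeasure
      = π ^ 2 * (Real.cos c * Real.cos c' * fourierCC f m n) := by
  have hF : Integrable (Function.uncurry f) squareMeasure :=
    (h.1.memLp (by linarith)).integrable (by simpa using hp.le)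
  have hsin : ∀ t : ℝ, Real.cos (t + -(π / 2)) = Real.sin t := fun t => by
    rw [← sub_eq_add_neg, Real.cos_sub_pi_div_two]
  have hcc : ∫ z, Function.uncurry f z * trigTest m n 0 0 z ∂squareMeasure
      = π ^ 2 * fourierCC f m n := by
    rw [← integral_integral_eq_squareMeasure (hF.mul_trigTest _ _ _ _), fourierCC]
    simp only [trigTest, Function.uncurry_apply_pair, add_zero, ← mul_assoc]
    field_simp
  have hsc : ∫ z, Function.uncurry f z * trigTest m n (-(π / 2)) 0 z ∂squareMeasure = 0 := by
    have h0 := (h.2.2.2 m n).1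
    rw [← integral_integral_eq_squareMeasure (hF.mul_trigTest _ _ _ _)]
    rw [fourierSC, mul_eq_zero, or_iff_right (by positivity)] at h0
    simpa only [trigTest, Function.uncurry_apply_pair, add_zero, ← mul_assoc, hsin] using h0
  have hcs : ∫ z, Function.uncurry f z * trigTest m n 0 (-(π / 2)) z ∂squareMeasure = 0 := by
    have h0 := (h.2.2.2 m n).2.1
    rw [← integral_integral_eq_squareMeasure (hF.mul_trigTest _ _ _ _)]
    rw [fourierCS, mul_eq_zero, or_iff_right (by positivity)] at h0
    simpa only [trigTest, Function.uncurry_apply_pair, add_zero, ← mul_assoc, hsin] using h0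
  have hss : ∫ z, Function.uncurry f z * trigTest m n (-(π / 2)) (-(π / 2)) z ∂squareMeasure
      = 0 := by
    have h0 := (h.2.2.2 m n).2.2
    rw [← integral_integral_eq_squareMeasure (hF.mul_trigTest _ _ _ _)]
    rw [fourierSS, mul_eq_zero, or_iff_right (by positivity)] at h0
    simpa only [trigTest, Function.uncurry_apply_pair, add_zero, ← mul_assoc, hsin] using h0
  have hexp : ∀ z, Function.uncurry f z * trigTest m n c c' z
      = Real.cos c * Real.cos c' * (Function.uncurry f z * trigTest m n 0 0 z)
        + -(Real.sin c * Real.cos c') * (Function.uncurry f z * trigTest m n (-(π / 2)) 0 z)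
        + -(Real.cos c * Real.sin c') * (Function.uncurry f z * trigTest m n 0 (-(π / 2)) z)
        + Real.sin c * Real.sin c'
          * (Function.uncurry f z * trigTest m n (-(π / 2)) (-(π / 2)) z) := by
    intro z
    simp only [trigTest, hsin, add_zero, Real.cos_add]
    ring
  have hi := fun a b r => (hF.mul_trigTest m n a b).const_mul r
  simp only [hexp]
  rw [integral_add ?_ (hi _ _ _), integral_add ?_ (hi _ _ _), integral_add (hi _ _ _) (hi _ _ _)]
  · simp only [integral_const_mul, hcc, hsc, hcs, hss]
    ring
  · exact (hi _ _ _).add (hi _ _ _)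
  · exact ((hi _ _ _).add (hi _ _ _)).add (hi _ _ _)

/-- The square partial sums of a lacunary series. -/
def lacunarySum (lam : ℕ → ℕ → ℝ) (N : ℕ) : ℝ × ℝ → ℝ :=
  dyadicPoly (fun _ => 0) (fun _ => 0) lam N

lemma InLambdaClass.integral_sub_lacunarySum_mul {p : ℝ} {f : ℝ → ℝ → ℝ} {lam : ℕ → ℕ → ℝ}
    (hp : 1 < p) (h : InLambdaClass p f lam) {m n N : ℕ} (hm : m < N) (hn : n < N) (c c' : ℝ) :
    ∫ z, (Function.uncurry f z - lacunarySum lam N z) * trigTest m n c c' z ∂squareMeasure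
      = 0 := by
  have hF : Integrable (Function.uncurry f) squareMeasure :=
    (h.1.memLp (by linarith)).integrable (by simpa using hp.le)
  have hP : Integrable (lacunarySum lam N) squareMeasure :=
    (memLp_dyadicPoly _ _ _ _ 1).integrable le_rfl
  simp only [sub_mul]
  rw [integral_sub (hF.mul_trigTest _ _ _ _) (hP.mul_trigTest _ _ _ _),
    h.integral_mul_trigTest hp, sub_eq_zero]
  simp only [mul_comm (lacunarySum lam N _)]
  rw [lacunarySum, integral_trigTest_mul_dyadicPoly]
  simp only [sub_zero]
  by_cases hmn : ∃ μ₁ μ₂ : ℕ, m = 2 ^ μ₁ ∧ n = 2 ^ μ₂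
  · obtain ⟨a, b, rfl, rfl⟩ := hmn
    have ha : a ∈ Finset.range N := Finset.mem_range.2 ((Nat.lt_two_pow_self).trans hm)
    have hb : b ∈ Finset.range N := Finset.mem_range.2 ((Nat.lt_two_pow_self).trans hn)
    have hinj : ∀ a b : ℕ, (2 ^ a = 2 ^ b) = (a = b) := fun a b => by simp
    simp only [hinj]
    rw [Finset.sum_eq_single a (by intro i _ hi; simp [hi.symm]) (fun h => absurd ha h),
      Finset.sum_eq_single b (by intro i _ hi; simp [hi.symm]) (fun h => absurd hb h), h.2.1]
    simp only [if_true]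
    ring
  · rw [h.2.2.1 m n hmn, mul_zero, mul_zero]
    symm
    refine Finset.sum_eq_zero fun i _ => Finset.sum_eq_zero fun j _ => ?_
    split_ifs with h1 h2
    · exact absurd ⟨i, j, h1, h2⟩ hmn
    all_goals simp

lemma InLambdaClass.exists_coeffNorm_le {p : ℝ} {f : ℝ → ℝ → ℝ} {lam : ℕ → ℕ → ℝ}
    (hp : 1 < p) (h : InLambdaClass p f lam) : ∃ B, ∀ N, coeffNorm lam N ≤ B := by
  have hpq := Real.HolderConjugate.conjExponent hp
  obtain ⟨K, hK, hle⟩ := exists_eLpNorm_dyadicPoly_le p.conjExponent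
  have hF := h.1.memLp (by linarith)
  set E := (eLpNorm (Function.uncurry f) (ENNReal.ofReal p) squareMeasure).toReal
  have hE : 0 ≤ E := ENNReal.toReal_nonneg
  refine ⟨E * K, fun N => ?_⟩
  have hc0 := coeffNorm_nonneg lam N
  have h1 := abs_integral_mul_le hpq hF (memLp_dyadicPoly (fun _ => 0) (fun _ => 0) lam N _)
  rw [integral_mul_dyadicPoly (hF.integrable (by simpa using hp.le))] at h1
  have h2 := ENNReal.toReal_mono ENNReal.ofReal_ne_top (hle (fun _ => 0) (fun _ => 0) lam N)
  rw [ENNReal.toReal_ofReal (by positivity)] at h2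
  have h3 : ∑ i ∈ Finset.range N, ∑ j ∈ Finset.range N,
      lam i j * ∫ z, Function.uncurry f z * trigTest (2 ^ i) (2 ^ j) 0 0 z ∂squareMeasure
      = π ^ 2 * coeffNorm lam N ^ 2 := by
    rw [coeffNorm_sq, Finset.mul_sum]
    refine Finset.sum_congr rfl fun i _ => ?_
    rw [Finset.mul_sum]
    refine Finset.sum_congr rfl fun j _ => ?_
    rw [h.integral_mul_trigTest hp, h.2.1]
    simp
    ring
  rw [h3, abs_of_nonneg (by positivity)] at h1
  rcases hc0.eq_or_lt with h0 | hpos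
  · rw [← h0]; positivity
  refine le_of_mul_le_mul_right ?_ hpos
  calc coeffNorm lam N * coeffNorm lam N ≤ π ^ 2 * coeffNorm lam N ^ 2 := by
        rw [← sq]
        exact le_mul_of_one_le_left (sq_nonneg _) (one_le_pow₀ (by linarith [Real.pi_gt_three]))
    _ ≤ _ := h1
    _ ≤ E * (K * coeffNorm lam N) := by gcongr
    _ = _ := by ring

lemma monotone_coeffNorm_sq (d : ℕ → ℕ → ℝ) : Monotone fun N => coeffNorm d N ^ 2 := by
  intro M N hMN
  simp only [coeffNorm_sq]
  have hsub := Finset.range_mono hMN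
  refine (Finset.sum_le_sum fun i _ =>
    Finset.sum_le_sum_of_subset_of_nonneg hsub fun _ _ _ => sq_nonneg _).trans ?_
  exact Finset.sum_le_sum_of_subset_of_nonneg hsub fun _ _ _ =>
    Finset.sum_nonneg fun _ _ => sq_nonneg _

lemma sum_range_sum_range_ite (g : ℕ → ℕ → ℝ) {M N : ℕ} (hMN : M ≤ N) :
    ∑ i ∈ Finset.range N, ∑ j ∈ Finset.range N, (if i < M ∧ j < M then g i j else 0)
      = ∑ i ∈ Finset.range M, ∑ j ∈ Finset.range M, g i j := by
  have hsub := Finset.range_mono hMN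
  symm
  rw [← Finset.sum_subset hsub]
  · refine Finset.sum_congr rfl fun i hi => ?_
    rw [← Finset.sum_subset hsub]
    · refine Finset.sum_congr rfl fun j hj => ?_
      simp only [Finset.mem_range] at hi hj
      simp [hi, hj]
    · intro j _ hj
      simp only [Finset.mem_range] at hj
      simp [hj]
  · intro i _ hi
    simp only [Finset.mem_range] at hi
    simp [hi]

lemma dyadicPoly_sub_dyadicPoly (θ η : ℕ → ℝ) (d : ℕ → ℕ → ℝ) {M N : ℕ} (hMN : M ≤ N) :
    dyadicPoly θ η d N - dyadicPoly θ η d M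
      = dyadicPoly θ η (fun i j => if i < M ∧ j < M then 0 else d i j) N := by
  ext z
  simp only [Pi.sub_apply, dyadicPoly]
  rw [← sum_range_sum_range_ite _ hMN, ← Finset.sum_sub_distrib]
  refine Finset.sum_congr rfl fun i _ => ?_
  rw [← Finset.sum_sub_distrib]
  refine Finset.sum_congr rfl fun j _ => ?_
  split_ifs <;> ring

lemma coeffNorm_tail_sq (d : ℕ → ℕ → ℝ) {M N : ℕ} (hMN : M ≤ N) :
    coeffNorm (fun i j => if i < M ∧ j < M then 0 else d i j) N ^ 2
      = coeffNorm d N ^ 2 - coeffNorm d M ^ 2 := by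
  simp only [coeffNorm_sq]
  rw [← sum_range_sum_range_ite _ hMN, ← Finset.sum_sub_distrib]
  refine Finset.sum_congr rfl fun i _ => ?_
  rw [← Finset.sum_sub_distrib]
  refine Finset.sum_congr rfl fun j _ => ?_
  split_ifs <;> ring

/-- A lacunary series with square summable coefficients converges in `L_p`. -/
lemma exists_tendsto_lacunarySum {p : ℝ} (hp : 1 < p) {lam : ℕ → ℕ → ℝ} {B : ℝ}
    (hB : ∀ N, coeffNorm lam N ≤ B) :
    ∃ G : ℝ × ℝ → ℝ, MemLp G (ENNReal.ofReal p) squareMeasure ∧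
      Filter.Tendsto (fun N => eLpNorm (lacunarySum lam N - G) (ENNReal.ofReal p) squareMeasure)
        Filter.atTop (nhds 0) := by
  have : Fact ((1:ℝ≥0∞) ≤ ENNReal.ofReal p) := ⟨by simpa using hp.le⟩
  obtain ⟨K, hK, hle⟩ := exists_eLpNorm_dyadicPoly_le p
  have hmem := memLp_dyadicPoly (fun _ => 0) (fun _ => 0) lam
  have hmono := monotone_coeffNorm_sq lam
  have hbdd : BddAbove (Set.range fun N => coeffNorm lam N ^ 2) :=
    ⟨B ^ 2, by rintro _ ⟨N, rfl⟩; exact pow_le_pow_left₀ (coeffNorm_nonneg _ _) (hB N) 2⟩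
  set S := ⨆ N, coeffNorm lam N ^ 2 with hS
  have hlim : Filter.Tendsto (fun N => coeffNorm lam N ^ 2) Filter.atTop (nhds S) :=
    tendsto_atTop_ciSup hmono hbdd
  set b : ℕ → ℝ≥0∞ := fun M => ENNReal.ofReal (K * √(S - coeffNorm lam M ^ 2)) with hb
  have hdist : ∀ M N, M ≤ N →
      edist ((hmem N (ENNReal.ofReal p)).toLp _) ((hmem M (ENNReal.ofReal p)).toLp _) ≤ b M := by
    intro M N hMN
    rw [Lp.edist_toLp_toLp, dyadicPoly_sub_dyadicPoly _ _ _ hMN]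
    refine (hle _ _ _ _).trans (ENNReal.ofReal_le_ofReal ?_)
    gcongr
    refine Real.le_sqrt_of_sq_le ?_
    rw [coeffNorm_tail_sq _ hMN]
    gcongr
    exact le_ciSup hbdd N
  have hb0 : Filter.Tendsto (fun M => b M + b M) Filter.atTop (nhds 0) := by
    have h1 : Filter.Tendsto (fun M => K * √(S - coeffNorm lam M ^ 2)) Filter.atTop
        (nhds (K * √(S - S))) := (((tendsto_const_nhds.sub hlim)).sqrt).const_mul K
    have h2 := (ENNReal.continuous_ofReal.tendsto _).comp h1
    simp only [sub_self, Real.sqrt_zero, mul_zero, ENNReal.ofReal_zero] at h2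
    simpa using h2.add h2
  have hcau : CauchySeq fun N => (hmem N (ENNReal.ofReal p)).toLp _ := by
    rw [EMetric.cauchySeq_iff_le_tendsto_0]
    refine ⟨_, fun n m N hn hm => ?_, hb0⟩
    refine (edist_triangle_right _ _ ((hmem N (ENNReal.ofReal p)).toLp _)).trans ?_
    exact add_le_add (hdist N n hn) (hdist N m hm)
  obtain ⟨G, hG⟩ := cauchySeq_tendsto_of_complete hcau
  refine ⟨G, Lp.memLp G, ?_⟩
  rw [tendsto_iff_edist_tendsto_0] at hG
  refine hG.congr fun N => ?_
  rw [Lp.edist_def]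
  refine eLpNorm_congr_ae ?_
  filter_upwards [(hmem N (ENNReal.ofReal p)).coeFn_toLp] with z hz
  simp [hz, lacunarySum]

lemma memLp_trigTest (m n : ℕ) (c c' : ℝ) (q : ℝ≥0∞) :
    MemLp (trigTest m n c c') q squareMeasure :=
  MemLp.of_bound (continuous_trigTest m n c c').aestronglyMeasurable 1
    (Filter.Eventually.of_forall fun z => abs_trigTest_le_one m n c c' z)

/-- A function of class `Λ_p` is the `L_p` limit of its square partial sums. -/
lemma InLambdaClass.tendsto_eLpNorm_sub_lacunarySum {p : ℝ} {f : ℝ → ℝ → ℝ} {lam : ℕ → ℕ → ℝ}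
    (hp : 1 < p) (h : InLambdaClass p f lam) :
    Filter.Tendsto (fun N => eLpNorm (Function.uncurry f - lacunarySum lam N)
      (ENNReal.ofReal p) squareMeasure) Filter.atTop (nhds 0) := by
  have hp1 : (1:ℝ≥0∞) ≤ ENNReal.ofReal p := by simpa using hp.le
  have hpq := Real.HolderConjugate.conjExponent hp
  obtain ⟨B, hB⟩ := h.exists_coeffNorm_le hp
  obtain ⟨G, hG, hlim⟩ := exists_tendsto_lacunarySum hp hB
  have hF := h.1.memLp (by linarith)
  have hP : ∀ N, MemLp (lacunarySum lam N) (ENNReal.ofReal p) squareMeasure := fun N =>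
    memLp_dyadicPoly _ _ _ _ _
  have hzero : Function.uncurry f - G =ᵐ[squareMeasure] 0 := by
    refine ae_eq_zero_of_integral_mul_trigTest ((hF.sub hG).integrable hp1) fun m n c c' => ?_
    set T := (eLpNorm (trigTest m n c c') (ENNReal.ofReal p.conjExponent) squareMeasure).toReal
    have hbound : ∀ᶠ N in Filter.atTop,
        |∫ z, (Function.uncurry f - G) z * trigTest m n c c' z ∂squareMeasure|
        ≤ (eLpNorm (lacunarySum lam N - G) (ENNReal.ofReal p) squareMeasure).toReal * T := by
      filter_upwards [Filter.eventually_gt_atTop m, Filter.eventually_gt_atTop n] with N hm hn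
      have hsplit : ∫ z, (Function.uncurry f - G) z * trigTest m n c c' z ∂squareMeasure
          = ∫ z, (Function.uncurry f - lacunarySum lam N) z * trigTest m n c c' z ∂squareMeasure
            + ∫ z, (lacunarySum lam N - G) z * trigTest m n c c' z ∂squareMeasure := by
        rw [← integral_add (((hF.sub (hP N)).integrable hp1).mul_trigTest _ _ _ _)
          ((((hP N).sub hG).integrable hp1).mul_trigTest _ _ _ _)]
        congr 1
        ext z
        simp only [Pi.sub_apply]
        ring
      rw [hsplit]
      simp only [Pi.sub_apply (Function.uncurry f)]
      rw [h.integral_sub_lacunarySum_mul hp hm hn, zero_add]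
      exact abs_integral_mul_le hpq ((hP N).sub hG) (memLp_trigTest m n c c' _)
    have hto : Filter.Tendsto (fun N =>
        (eLpNorm (lacunarySum lam N - G) (ENNReal.ofReal p) squareMeasure).toReal * T)
        Filter.atTop (nhds 0) := by
      have := ((ENNReal.tendsto_toReal ENNReal.zero_ne_top).comp hlim).mul_const T
      simpa using this
    exact abs_nonpos_iff.1 (ge_of_tendsto hto hbound)
  refine hlim.congr fun N => ?_
  rw [← eLpNorm_neg, neg_sub]
  refine eLpNorm_congr_ae ?_
  filter_upwards [hzero] with z hz
  simp only [Pi.sub_apply, Pi.zero_apply, sub_eq_zero] at hz ⊢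
  rw [hz]

/-- Minkowski's inequality for countable sums. -/
lemma lintegral_tsum_rpow_le {Ω : Type*} [MeasurableSpace Ω] {μ : Measure Ω} {p : ℝ} (hp : 1 ≤ p)
    {G : ℕ → Ω → ℝ≥0∞} (hG : ∀ n, Measurable (G n)) :
    (∫⁻ a, (∑' n, G n a) ^ p ∂μ) ^ (1 / p) ≤ ∑' n, (∫⁻ a, G n a ^ p ∂μ) ^ (1 / p) := by
  have hp0 : 0 < p := by linarith
  have hfin : ∀ N, (∫⁻ a, (∑ n ∈ Finset.range N, G n a) ^ p ∂μ) ^ (1 / p)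
      ≤ ∑ n ∈ Finset.range N, (∫⁻ a, G n a ^ p ∂μ) ^ (1 / p) := by
    intro N
    induction N with
    | zero => simp [hp0]
    | succ N ih =>
      simp only [Finset.sum_range_succ]
      refine (ENNReal.lintegral_Lp_add_le (f := fun a => ∑ n ∈ Finset.range N, G n a)
        (Finset.measurable_fun_sum _ fun n _ => hG n).aemeasurable (hG N).aemeasurable hp).trans ?_
      gcongr
  have hlim : Filter.Tendsto (fun N => ∫⁻ a, (∑ n ∈ Finset.range N, G n a) ^ p ∂μ) Filter.atTop
      (nhds (∫⁻ a, (∑' n, G n a) ^ p ∂μ)) := by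
    refine lintegral_tendsto_of_tendsto_of_monotone
      (fun N => ((Finset.measurable_fun_sum _ fun n _ => hG n).pow_const p).aemeasurable)
      (Filter.Eventually.of_forall fun a M N hMN => ?_) (Filter.Eventually.of_forall fun a => ?_)
    · exact ENNReal.rpow_le_rpow (Finset.sum_le_sum_of_subset (Finset.range_mono hMN)) hp0.le
    · exact (ENNReal.continuous_rpow_const.tendsto _).comp (ENNReal.tendsto_nat_tsum _)
  refine le_of_tendsto ((ENNReal.continuous_rpow_const.tendsto _).comp hlim)
    (Filter.Eventually.of_forall fun N => ?_)
  exact (hfin N).trans (ENNReal.sum_le_tsum _)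

lemma lintegral_comp_add_right_periodMeasure {g : ℝ → ℝ≥0∞} (hg : Function.Periodic g (2 * π))
    (a : ℝ) : ∫⁻ x, g (x + a) ∂periodMeasure = ∫⁻ x, g x ∂periodMeasure := by
  have hpre : (fun x : ℝ => x + a) ⁻¹' Set.Ioc a (a + 2 * π) = Set.Ioc 0 (2 * π) := by
    ext x
    simp only [Set.mem_preimage, Set.mem_Ioc]
    constructor <;> rintro ⟨h1, h2⟩ <;> constructor <;> linarith
  rw [periodMeasure, ← hpre,
    (measurePreserving_add_right volume a).setLIntegral_comp_preimage_emb
      (measurableEmbedding_addRight a), hpre]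
  have h0 := isAddFundamentalDomain_Ioc (T := 2 * π) (by positivity) 0
  rw [zero_add] at h0
  refine (isAddFundamentalDomain_Ioc (T := 2 * π) (by positivity) a).setLIntegral_eq h0 g ?_
  rintro ⟨_, n, rfl⟩ x
  change g (n • (2 * π) + x) = g x
  rw [add_comm]
  exact hg.zsmul n x

lemma lintegral_shift_squareMeasure {H : ℝ × ℝ → ℝ≥0∞} (hH : Measurable H)
    (hx : ∀ y, Function.Periodic (fun x => H (x, y)) (2 * π))
    (hy : ∀ x, Function.Periodic (fun y => H (x, y)) (2 * π)) (a b : ℝ) :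
    ∫⁻ z, H (z.1 + a, z.2 + b) ∂squareMeasure = ∫⁻ z, H z ∂squareMeasure := by
  rw [squareMeasure, lintegral_prod _ hH.aemeasurable,
    lintegral_prod _ (by fun_prop : Measurable fun z : ℝ × ℝ => H (z.1 + a, z.2 + b)).aemeasurable]
  simp only
  calc ∫⁻ x, ∫⁻ y, H (x + a, y + b) ∂periodMeasure ∂periodMeasure
      = ∫⁻ x, ∫⁻ y, H (x + a, y) ∂periodMeasure ∂periodMeasure :=
        lintegral_congr fun x => lintegral_comp_add_right_periodMeasure (hy (x + a)) b
    _ = _ := by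
        refine lintegral_comp_add_right_periodMeasure
          (g := fun x => ∫⁻ y, H (x, y) ∂periodMeasure) (fun x => ?_) a
        exact lintegral_congr fun y => hx y x

/-- A majorant of the mixed difference of a function bounded by `H`. -/
def diffMajorant (α₁ h₁ α₂ h₂ : ℝ) (H : ℝ × ℝ → ℝ≥0∞) (z : ℝ × ℝ) : ℝ≥0∞ :=
  ∑' ν : ℕ, ‖diffCoeff α₁ ν‖ₑ *
    ∑' κ : ℕ, ‖diffCoeff α₂ κ‖ₑ * H (z.1 + (α₁ - ν) * h₁, z.2 + (α₂ - κ) * h₂)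

lemma lintegral_const_mul_rpow {Ω : Type*} [MeasurableSpace Ω] {μ : Measure Ω} {p : ℝ}
    (hp : 0 < p) (c : ℝ≥0∞) {u : Ω → ℝ≥0∞} (hu : Measurable u) :
    (∫⁻ a, (c * u a) ^ p ∂μ) ^ (1 / p) = c * (∫⁻ a, u a ^ p ∂μ) ^ (1 / p) := by
  simp only [ENNReal.mul_rpow_of_nonneg _ _ hp.le]
  rw [lintegral_const_mul _ (hu.pow_const p), ENNReal.mul_rpow_of_nonneg _ _ (by positivity),
    ← ENNReal.rpow_mul, mul_one_div_cancel hp.ne', ENNReal.rpow_one]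

lemma lintegral_diffMajorant_rpow_le {p : ℝ} (hp : 1 ≤ p) (α₁ h₁ α₂ h₂ : ℝ) {H : ℝ × ℝ → ℝ≥0∞}
    (hH : Measurable H) (hx : ∀ y, Function.Periodic (fun x => H (x, y)) (2 * π))
    (hy : ∀ x, Function.Periodic (fun y => H (x, y)) (2 * π)) :
    (∫⁻ z, diffMajorant α₁ h₁ α₂ h₂ H z ^ p ∂squareMeasure) ^ (1 / p)
      ≤ (∑' ν, ‖diffCoeff α₁ ν‖ₑ) * ((∑' κ, ‖diffCoeff α₂ κ‖ₑ)
        * (∫⁻ z, H z ^ p ∂squareMeasure) ^ (1 / p)) := by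
  have hp0 : 0 < p := by linarith
  have hms : ∀ a b : ℝ, Measurable fun z : ℝ × ℝ => H (z.1 + a, z.2 + b) := fun a b => by fun_prop
  have hmi : ∀ ν : ℕ, Measurable fun z : ℝ × ℝ =>
      ∑' κ : ℕ, ‖diffCoeff α₂ κ‖ₑ * H (z.1 + (α₁ - ν) * h₁, z.2 + (α₂ - κ) * h₂) := fun ν =>
    Measurable.tsum fun κ => (hms _ _).const_mul _
  unfold diffMajorant
  refine (lintegral_tsum_rpow_le hp fun ν => (hmi ν).const_mul _).trans ?_
  rw [← ENNReal.tsum_mul_right]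
  refine ENNReal.tsum_le_tsum fun ν => ?_
  rw [lintegral_const_mul_rpow hp0 _ (hmi ν)]
  gcongr
  refine (lintegral_tsum_rpow_le hp fun κ => (hms _ _).const_mul _).trans ?_
  rw [← ENNReal.tsum_mul_right]
  refine ENNReal.tsum_le_tsum fun κ => ?_
  rw [lintegral_const_mul_rpow hp0 _ (hms _ _)]
  refine mul_le_mul_right (ENNReal.rpow_le_rpow (le_of_eq ?_) (by positivity)) _
  refine (lintegral_shift_squareMeasure (H := fun z => H z ^ p) (hH.pow_const p)
    (fun y x => ?_) (fun x y => ?_) _ _)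
  · simp only [hx y x]
  · simp only [hy x y]

lemma enorm_tsum_tsum_sub_le {a a' : ℕ → ℝ} (ha : Summable fun ν => |a ν|)
    (ha' : Summable fun κ => |a' κ|) (t u : ℕ → ℕ → ℝ) {B : ℝ} (hu : ∀ ν κ, |u ν κ| ≤ B) :
    ‖∑' ν, a ν * ∑' κ, a' κ * t ν κ - ∑' ν, a ν * ∑' κ, a' κ * u ν κ‖ₑ
      ≤ ∑' ν, ‖a ν‖ₑ * ∑' κ, ‖a' κ‖ₑ * ‖t ν κ - u ν κ‖ₑ := by
  by_cases htop : ∑' ν, ‖a ν‖ₑ * ∑' κ, ‖a' κ‖ₑ * ‖t ν κ - u ν κ‖ₑ = ⊤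
  · rw [htop]; exact le_top
  have hsum : ∀ x : ℕ → ℝ, ∑' n, ‖x n‖ₑ ≠ ⊤ → Summable x := fun x hx =>
    Summable.of_nnnorm (ENNReal.tsum_coe_ne_top_iff_summable.1 hx)
  have hu' : ∀ ν, Summable fun κ => a' κ * u ν κ := fun ν =>
    Summable.of_norm_bounded (ha'.mul_right B) fun κ => by
      rw [Real.norm_eq_abs, abs_mul]
      exact mul_le_mul_of_nonneg_left (hu ν κ) (abs_nonneg _)
  have hinner : ∀ ν, a ν * ∑' κ, a' κ * t ν κ
      = a ν * ∑' κ, a' κ * (t ν κ - u ν κ) + a ν * ∑' κ, a' κ * u ν κ := by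
    intro ν
    by_cases h0 : a ν = 0
    · simp [h0]
    have hs : Summable fun κ => a' κ * (t ν κ - u ν κ) := by
      refine hsum _ ?_
      simp only [enorm_mul]
      intro hκ
      refine ENNReal.ne_top_of_tsum_ne_top htop ν ?_
      rw [hκ, ENNReal.mul_top (by simpa using h0)]
    rw [← mul_add, ← hs.tsum_add (hu' ν)]
    simp only [← mul_add, sub_add_cancel]
  have hbound : ∀ ν, ‖a ν * ∑' κ, a' κ * (t ν κ - u ν κ)‖ₑ
      ≤ ‖a ν‖ₑ * ∑' κ, ‖a' κ‖ₑ * ‖t ν κ - u ν κ‖ₑ := by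
    intro ν
    rw [enorm_mul]
    gcongr
    refine enorm_tsum_le_tsum_enorm.trans (le_of_eq ?_)
    simp only [enorm_mul]
  have hs1 : Summable fun ν => a ν * ∑' κ, a' κ * (t ν κ - u ν κ) :=
    hsum _ ((ENNReal.tsum_le_tsum hbound).trans_lt (lt_top_iff_ne_top.2 htop)).ne
  have hs2 : Summable fun ν => a ν * ∑' κ, a' κ * u ν κ := by
    refine Summable.of_norm_bounded (ha.mul_right ((∑' κ, |a' κ|) * B)) fun ν => ?_
    rw [norm_mul, Real.norm_eq_abs]
    refine mul_le_mul_of_nonneg_left ?_ (abs_nonneg _)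
    rw [← tsum_mul_right]
    refine tsum_of_norm_bounded (ha'.mul_right B).hasSum fun κ => ?_
    rw [Real.norm_eq_abs, abs_mul]
    exact mul_le_mul_of_nonneg_left (hu ν κ) (abs_nonneg _)
  rw [tsum_congr hinner, hs1.tsum_add hs2, add_sub_cancel_right]
  exact enorm_tsum_le_tsum_enorm.trans (ENNReal.tsum_le_tsum hbound)

/-- The mixed fractional difference of a function on the plane. -/
def mixedDiff (α₁ h₁ α₂ h₂ : ℝ) (H : ℝ × ℝ → ℝ) (z : ℝ × ℝ) : ℝ :=
  ∑' ν : ℕ, diffCoeff α₁ ν *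
    ∑' κ : ℕ, diffCoeff α₂ κ * H (z.1 + (α₁ - ν) * h₁, z.2 + (α₂ - κ) * h₂)

lemma measurable_mixedDiff (α₁ h₁ α₂ h₂ : ℝ) {H : ℝ × ℝ → ℝ} (hH : Measurable H) :
    Measurable (mixedDiff α₁ h₁ α₂ h₂ H) := by
  unfold mixedDiff
  exact Measurable.tsum fun ν => (Measurable.tsum fun κ => by fun_prop).const_mul _

/-- The Fourier coefficients of the mixed difference of a lacunary series, up to phases. -/
def diffCoeffs (α₁ h₁ α₂ h₂ : ℝ) (lam : ℕ → ℕ → ℝ) (i j : ℕ) : ℝ :=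
  lam i j * diffGain α₁ h₁ (2 ^ i) * diffGain α₂ h₂ (2 ^ j)

lemma exists_mixedDiff_lacunarySum {α₁ α₂ : ℝ} (hα₁ : 0 < α₁) (hα₂ : 0 < α₂) (h₁ h₂ : ℝ)
    (lam : ℕ → ℕ → ℝ) : ∃ ξ η : ℕ → ℝ, ∀ N,
      mixedDiff α₁ h₁ α₂ h₂ (lacunarySum lam N)
        = dyadicPoly ξ η (diffCoeffs α₁ h₁ α₂ h₂ lam) N := by
  have hwave : ∀ {α : ℝ}, 0 < α → ∀ h : ℝ, ∃ ξ : ℕ → ℝ, ∀ (i : ℕ) (x : ℝ),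
      HasSum (fun ν : ℕ => diffCoeff α ν * dyadicWave (fun _ => 0) i (x + (α - ν) * h))
        (diffGain α h (2 ^ i) * dyadicWave ξ i x) := by
    intro α hα h
    choose ξ hξ using fun i : ℕ => exists_diffPhase hα h (2 ^ i)
    refine ⟨ξ, fun i x => ?_⟩
    have hs : Summable fun ν : ℕ =>
        diffCoeff α ν * dyadicWave (fun _ => 0) i (x + (α - ν) * h) :=
      Summable.of_norm_bounded (summable_abs_diffCoeff hα) fun ν => by
        rw [norm_mul]
        exact mul_le_of_le_one_right (norm_nonneg _) (abs_dyadicWave_le_one _ _ _)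
    have h1 := hs.hasSum
    have h2 := hξ i x
    simp only [dyadicWave, add_zero] at h1 ⊢
    rwa [h2] at h1
  obtain ⟨ξ, hξ⟩ := hwave hα₁ h₁
  obtain ⟨η, hη⟩ := hwave hα₂ h₂
  refine ⟨ξ, η, fun N => funext fun z => ?_⟩
  have hin : ∀ ν : ℕ, ∑' κ : ℕ, diffCoeff α₂ κ *
      lacunarySum lam N (z.1 + (α₁ - ν) * h₁, z.2 + (α₂ - κ) * h₂)
      = ∑ i ∈ Finset.range N, ∑ j ∈ Finset.range N, lam i j *
        dyadicWave (fun _ => 0) i (z.1 + (α₁ - ν) * h₁)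
        * (diffGain α₂ h₂ (2 ^ j) * dyadicWave η j z.2) := by
    intro ν
    refine HasSum.tsum_eq ?_
    simp only [lacunarySum, dyadicPoly, Finset.mul_sum, mul_left_comm (diffCoeff _ _)]
    exact hasSum_sum fun i _ => hasSum_sum fun j _ => (hη j z.2).mul_left _
  rw [mixedDiff]
  simp only [hin]
  refine HasSum.tsum_eq ?_
  simp only [dyadicPoly, Finset.mul_sum]
  refine hasSum_sum fun i _ => hasSum_sum fun j _ => ?_
  convert! (hξ i z.1).mul_left (lam i j * (diffGain α₂ h₂ (2 ^ j) * dyadicWave η j z.2)) using 1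
  · ext ν
    ring
  · rw [diffCoeffs]
    ring

lemma tsum_enorm_diffCoeff_ne_top {α : ℝ} (hα : 0 < α) : ∑' ν, ‖diffCoeff α ν‖ₑ ≠ ⊤ :=
  ENNReal.tsum_coe_ne_top_iff_summable.2 (by
    rw [← NNReal.summable_coe]
    simpa using summable_abs_diffCoeff hα)

/-- The mixed difference of a function of class `Λ_p` is the `L_p` limit of the mixed
differences of its partial sums. -/
lemma InLambdaClass.tendsto_eLpNorm_mixedDiff {p α₁ α₂ : ℝ} (hp : 1 < p) (hα₁ : 0 < α₁)
    (hα₂ : 0 < α₂) {f : ℝ → ℝ → ℝ} {lam : ℕ → ℕ → ℝ} (h : InLambdaClass p f lam) (h₁ h₂ : ℝ) :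
    Filter.Tendsto (fun N => eLpNorm (mixedDiff α₁ h₁ α₂ h₂ (Function.uncurry f)
      - mixedDiff α₁ h₁ α₂ h₂ (lacunarySum lam N)) (ENNReal.ofReal p) squareMeasure)
      Filter.atTop (nhds 0) := by
  have hp0 : 0 < p := by linarith
  set A := ∑' ν, ‖diffCoeff α₁ ν‖ₑ
  set A' := ∑' ν, ‖diffCoeff α₂ ν‖ₑ
  have hA : A ≠ ⊤ := tsum_enorm_diffCoeff_ne_top hα₁
  have hA' : A' ≠ ⊤ := tsum_enorm_diffCoeff_ne_top hα₂
  have hlim : Filter.Tendsto (fun N => A * (A' * eLpNorm (Function.uncurry f - lacunarySum lam N)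
      (ENNReal.ofReal p) squareMeasure)) Filter.atTop (nhds 0) := by
    have h0 := h.tendsto_eLpNorm_sub_lacunarySum hp
    have h1 := ENNReal.Tendsto.const_mul h0 (Or.inr hA')
    have h2 := ENNReal.Tendsto.const_mul h1 (Or.inr hA)
    simpa using h2
  refine tendsto_of_tendsto_of_tendsto_of_le_of_le tendsto_const_nhds hlim
    (fun _ => zero_le) fun N => ?_
  have hP : Continuous (lacunarySum lam N) := continuous_dyadicPoly _ _ _ _
  have hmeas : Measurable fun z => ‖Function.uncurry f z - lacunarySum lam N z‖ₑ :=
    (h.1.meas.sub hP.measurable).enorm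
  have hper : ∀ (i : ℕ) (x : ℝ), dyadicWave (fun _ => 0) i (x + 2 * π)
      = dyadicWave (fun _ => 0) i x := by
    intro i x
    have : (2:ℝ) ^ i * (x + 2 * π) + 0 = 2 ^ i * x + 0 + ((2 ^ i : ℕ) : ℝ) * (2 * π) := by
      push_cast; ring
    simp only [dyadicWave]
    rw [this, Real.cos_add_nat_mul_two_pi]
  have hmain := lintegral_diffMajorant_rpow_le hp.le α₁ h₁ α₂ h₂ hmeas
    (fun y x => by
      have := h.1.periodic_x y x
      simp only [Function.uncurry_apply_pair] at this ⊢
      rw [this]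
      simp only [lacunarySum, dyadicPoly, hper])
    (fun x y => by
      have := h.1.periodic_y x y
      simp only [Function.uncurry_apply_pair] at this ⊢
      rw [this]
      simp only [lacunarySum, dyadicPoly, hper])
  rw [eLpNorm_eq_lintegral_rpow_enorm_toReal (by simpa using hp0) ENNReal.ofReal_ne_top,
    eLpNorm_eq_lintegral_rpow_enorm_toReal (by simpa using hp0) ENNReal.ofReal_ne_top,
    ENNReal.toReal_ofReal hp0.le]
  refine le_trans ?_ hmain
  gcongr with z
  exact enorm_tsum_tsum_sub_le (summable_abs_diffCoeff hα₁) (summable_abs_diffCoeff hα₂)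
    (fun ν κ => Function.uncurry f (z.1 + (α₁ - ν) * h₁, z.2 + (α₂ - κ) * h₂))
    (fun ν κ => lacunarySum lam N (z.1 + (α₁ - ν) * h₁, z.2 + (α₂ - κ) * h₂))
    fun ν κ => abs_dyadicPoly_le _ _ _ _ _

/-- The sum of squares of a double sequence. -/
def sqSum (d : ℕ → ℕ → ℝ) : ℝ≥0∞ := ∑' (i : ℕ) (j : ℕ), ENNReal.ofReal (d i j ^ 2)

lemma ofReal_coeffNorm (d : ℕ → ℕ → ℝ) (N : ℕ) : ENNReal.ofReal (coeffNorm d N)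
    = (∑ i ∈ Finset.range N, ∑ j ∈ Finset.range N, ENNReal.ofReal (d i j ^ 2)) ^ ((1:ℝ) / 2) := by
  have h : ∑ i ∈ Finset.range N, ∑ j ∈ Finset.range N, ENNReal.ofReal (d i j ^ 2)
      = ENNReal.ofReal (∑ i ∈ Finset.range N, ∑ j ∈ Finset.range N, d i j ^ 2) := by
    rw [ENNReal.ofReal_sum_of_nonneg fun i _ => Finset.sum_nonneg fun j _ => sq_nonneg _]
    refine Finset.sum_congr rfl fun i _ => ?_
    rw [ENNReal.ofReal_sum_of_nonneg fun j _ => sq_nonneg _]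
  rw [h, coeffNorm, Real.sqrt_eq_rpow, ENNReal.ofReal_rpow_of_nonneg _ (by norm_num)]
  exact Finset.sum_nonneg fun i _ => Finset.sum_nonneg fun j _ => sq_nonneg _

lemma ofReal_coeffNorm_le_sqSum (d : ℕ → ℕ → ℝ) (N : ℕ) :
    ENNReal.ofReal (coeffNorm d N) ≤ sqSum d ^ ((1:ℝ) / 2) := by
  rw [ofReal_coeffNorm]
  refine ENNReal.rpow_le_rpow ?_ (by norm_num)
  exact (Finset.sum_le_sum fun i _ => ENNReal.sum_le_tsum _).trans (ENNReal.sum_le_tsum _)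

lemma monotone_coeffNorm (d : ℕ → ℕ → ℝ) : Monotone (coeffNorm d) := fun _ _ hMN =>
  (pow_le_pow_iff_left₀ (coeffNorm_nonneg _ _) (coeffNorm_nonneg _ _) two_ne_zero).1
    (monotone_coeffNorm_sq d hMN)

lemma sqSum_rpow_le {d : ℕ → ℕ → ℝ} {c : ℝ≥0∞} (hc : ∀ N, ENNReal.ofReal (coeffNorm d N) ≤ c) :
    sqSum d ^ ((1:ℝ) / 2) ≤ c := by
  rw [one_div, ENNReal.rpow_inv_le_iff (by norm_num)]
  refine ENNReal.tsum_le_of_sum_range_le fun n => ?_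
  have hlim : Filter.Tendsto
      (fun m => ∑ i ∈ Finset.range n, ∑ j ∈ Finset.range m, ENNReal.ofReal (d i j ^ 2))
      Filter.atTop (nhds (∑ i ∈ Finset.range n, ∑' j, ENNReal.ofReal (d i j ^ 2))) :=
    tendsto_finsetSum _ fun i _ => ENNReal.tendsto_nat_tsum _
  refine le_of_tendsto hlim (Filter.Eventually.of_forall fun m => ?_)
  rw [← ENNReal.rpow_inv_le_iff (by norm_num), ← one_div]
  refine le_trans ?_ (hc (max n m))
  rw [ofReal_coeffNorm]
  refine ENNReal.rpow_le_rpow ?_ (by norm_num)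
  refine (Finset.sum_le_sum fun i _ => Finset.sum_le_sum_of_subset
    (Finset.range_mono (le_max_right n m))).trans ?_
  exact Finset.sum_le_sum_of_subset (Finset.range_mono (le_max_left n m))

/-- The `L_p` norm of a mixed difference is equivalent to the `ℓ²` norm of its coefficients. -/
lemma exists_Lp2Norm_diff_equiv {p α₁ α₂ : ℝ} (hp : 1 < p) (hα₁ : 0 < α₁) (hα₂ : 0 < α₂) :
    ∃ K : ℝ, 0 < K ∧ ∀ (f : ℝ → ℝ → ℝ) (lam : ℕ → ℕ → ℝ), InLambdaClass p f lam →
      ∀ h₁ h₂ : ℝ,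
        Lp2Norm p (diffX α₁ h₁ (diffY α₂ h₂ f))
          ≤ ENNReal.ofReal K * sqSum (diffCoeffs α₁ h₁ α₂ h₂ lam) ^ ((1:ℝ) / 2) ∧
        sqSum (diffCoeffs α₁ h₁ α₂ h₂ lam) ^ ((1:ℝ) / 2)
          ≤ ENNReal.ofReal K * Lp2Norm p (diffX α₁ h₁ (diffY α₂ h₂ f)) := by
  have hp0 : 0 < p := by linarith
  obtain ⟨K₁, hK₁, hup⟩ := exists_eLpNorm_dyadicPoly_le p
  obtain ⟨K₂, hK₂, hlow⟩ := exists_coeffNorm_le hp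
  refine ⟨max K₁ K₂, lt_max_of_lt_left hK₁, fun f lam h h₁ h₂ => ?_⟩
  set D := mixedDiff α₁ h₁ α₂ h₂ (Function.uncurry f) with hD
  have hDm : Measurable D := measurable_mixedDiff _ _ _ _ h.1.meas
  have hL : Lp2Norm p (diffX α₁ h₁ (diffY α₂ h₂ f))
      = eLpNorm D (ENNReal.ofReal p) squareMeasure :=
    Lp2Norm_eq_eLpNorm hp0 (g := diffX α₁ h₁ (diffY α₂ h₂ f)) hDm
  obtain ⟨ξ, η, hpoly⟩ := exists_mixedDiff_lacunarySum hα₁ hα₂ h₁ h₂ lam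
  set d := diffCoeffs α₁ h₁ α₂ h₂ lam
  have hlim := h.tendsto_eLpNorm_mixedDiff hp hα₁ hα₂ h₁ h₂
  simp only [hpoly, ← hD] at hlim
  set P := dyadicPoly ξ η d
  have hPm : ∀ N, Measurable (P N) := fun N => (continuous_dyadicPoly ξ η d N).measurable
  have hp1 : 1 ≤ ENNReal.ofReal p := by simpa using hp.le
  set e : ℕ → ℝ≥0∞ := fun N => eLpNorm (D - P N) (ENNReal.ofReal p) squareMeasure with he
  have hDP : ∀ N, eLpNorm D (ENNReal.ofReal p) squareMeasure
      ≤ e N + eLpNorm (P N) (ENNReal.ofReal p) squareMeasure := fun N => by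
    have := eLpNorm_add_le (hDm.sub (hPm N)).aestronglyMeasurable
      (hPm N).aestronglyMeasurable hp1 (μ := squareMeasure)
    rwa [sub_add_cancel] at this
  have hPD : ∀ N, eLpNorm (P N) (ENNReal.ofReal p) squareMeasure
      ≤ e N + eLpNorm D (ENNReal.ofReal p) squareMeasure := fun N => by
    have := eLpNorm_add_le ((hPm N).sub hDm).aestronglyMeasurable
      hDm.aestronglyMeasurable hp1 (μ := squareMeasure)
    rwa [sub_add_cancel, eLpNorm_sub_comm] at this
  rw [hL]
  constructor
  · have hto : Filter.Tendsto (fun N => e N + ENNReal.ofReal (max K₁ K₂) * sqSum d ^ ((1:ℝ) / 2))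
        Filter.atTop (nhds (0 + ENNReal.ofReal (max K₁ K₂) * sqSum d ^ ((1:ℝ) / 2))) :=
      hlim.add tendsto_const_nhds
    rw [zero_add] at hto
    refine ge_of_tendsto hto (Filter.Eventually.of_forall fun N => (hDP N).trans ?_)
    gcongr
    refine (hup ξ η d N).trans ?_
    rw [ENNReal.ofReal_mul hK₁.le]
    gcongr
    · exact le_max_left _ _
    · exact ofReal_coeffNorm_le_sqSum d N
  · refine sqSum_rpow_le fun n => ?_
    have hto : Filter.Tendsto (fun N => ENNReal.ofReal (max K₁ K₂) *
        (e N + eLpNorm D (ENNReal.ofReal p) squareMeasure)) Filter.atTop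
        (nhds (ENNReal.ofReal (max K₁ K₂) *
          (0 + eLpNorm D (ENNReal.ofReal p) squareMeasure))) :=
      ENNReal.Tendsto.const_mul (hlim.add tendsto_const_nhds) (Or.inr ENNReal.ofReal_ne_top)
    rw [zero_add] at hto
    refine ge_of_tendsto hto ?_
    filter_upwards [Filter.eventually_ge_atTop n] with N hN
    refine (ENNReal.ofReal_le_ofReal (monotone_coeffNorm d hN)).trans ((hlow ξ η d N).trans ?_)
    gcongr
    · exact le_max_right _ _
    · exact hPD N

lemma sqSum_split (d : ℕ → ℕ → ℝ) (m n : ℕ) : sqSum d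
    = ∑ i ∈ Finset.range m, ∑ j ∈ Finset.range n, ENNReal.ofReal (d i j ^ 2)
      + ∑ i ∈ Finset.range m, ∑' k, ENNReal.ofReal (d i (n + k) ^ 2)
      + ∑ j ∈ Finset.range n, ∑' k, ENNReal.ofReal (d (m + k) j ^ 2)
      + ∑' (i : ℕ) (j : ℕ), ENNReal.ofReal (d (m + i) (n + j) ^ 2) := by
  have hsplit : ∀ (g : ℕ → ℝ≥0∞) (k : ℕ),
      ∑' i, g i = ∑ i ∈ Finset.range k, g i + ∑' i, g (k + i) := fun g k => by
    simp only [add_comm k]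
    exact (ENNReal.summable.sum_add_tsum_nat_add' (k := k)).symm
  rw [sqSum, hsplit _ m]
  simp only [hsplit (fun j => ENNReal.ofReal (d _ j ^ 2)) n]
  rw [Finset.sum_add_distrib, ENNReal.tsum_add, Summable.tsum_finsetSum fun _ _ => ENNReal.summable]
  ring

lemma sqSum_mono_of_abs_le {d e : ℕ → ℕ → ℝ} {c : ℝ} (h : ∀ i j, |d i j| ≤ c * |e i j|) :
    sqSum d ^ ((1:ℝ) / 2) ≤ ENNReal.ofReal c * sqSum e ^ ((1:ℝ) / 2) := by
  by_cases hc : 0 ≤ c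
  swap
  · have h0 : ∀ i j, d i j = 0 := fun i j => by
      have := h i j
      have h1 : c * |e i j| ≤ 0 := mul_nonpos_of_nonpos_of_nonneg (not_le.1 hc).le (abs_nonneg _)
      exact abs_nonpos_iff.1 (this.trans h1)
    simp [sqSum, h0]
  have hle : sqSum d ≤ ENNReal.ofReal c ^ (2:ℝ) * sqSum e := by
    rw [sqSum, sqSum, ← ENNReal.tsum_mul_left]
    refine ENNReal.tsum_le_tsum fun i => ?_
    rw [← ENNReal.tsum_mul_left]
    refine ENNReal.tsum_le_tsum fun j => ?_
    rw [ENNReal.rpow_two, ← ENNReal.ofReal_pow hc, ← ENNReal.ofReal_mul (by positivity)]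
    refine ENNReal.ofReal_le_ofReal ?_
    rw [← sq_abs (d i j), ← sq_abs (e i j), ← mul_pow]
    exact pow_le_pow_left₀ (abs_nonneg _) (h i j) 2
  calc sqSum d ^ ((1:ℝ) / 2) ≤ (ENNReal.ofReal c ^ (2:ℝ) * sqSum e) ^ ((1:ℝ) / 2) :=
        ENNReal.rpow_le_rpow hle (by norm_num)
    _ = ENNReal.ofReal c * sqSum e ^ ((1:ℝ) / 2) := by
        rw [ENNReal.mul_rpow_of_nonneg _ _ (by norm_num), ← ENNReal.rpow_mul]
        norm_num

/-- Coefficients weighted by the model gain of the mixed differences of step `2 ^ (-n)`. -/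
def weightedCoeffs (α₁ : ℝ) (n₁ : ℕ) (α₂ : ℝ) (n₂ : ℕ) (lam : ℕ → ℕ → ℝ) (i j : ℕ) : ℝ :=
  lam i j * modWeight α₁ n₁ i * modWeight α₂ n₂ j

lemma modWeight_of_lt (α : ℝ) {n μ : ℕ} (h : n < μ) : modWeight α n μ = 1 :=
  if_neg (not_le.2 h)

lemma ofReal_mul_rpow_half {c : ℝ} (hc : 0 ≤ c) (X : ℝ≥0∞) :
    ENNReal.ofReal c * X ^ ((1:ℝ) / 2) = (ENNReal.ofReal (c ^ 2) * X) ^ ((1:ℝ) / 2) := by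
  rw [ENNReal.mul_rpow_of_nonneg _ _ (by norm_num), ENNReal.ofReal_rpow_of_nonneg (by positivity)
    (by norm_num), ← Real.sqrt_eq_rpow, Real.sqrt_sq hc]

lemma two_rpow_neg_sq_mul (α : ℝ) (n μ : ℕ) :
    ((2:ℝ) ^ (-(n:ℝ) * α)) ^ 2 * 2 ^ (2 * (μ:ℝ) * α) = ((2:ℝ) ^ (α * ((μ:ℝ) - n))) ^ 2 := by
  rw [← Real.rpow_mul_natCast two_pos.le, ← Real.rpow_mul_natCast two_pos.le,
    ← Real.rpow_add two_pos]
  congr 1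
  push_cast
  ring

/-- The four-term functional consists of the square roots of the four blocks of the weighted
sum of squares. -/
lemma Lfun_eq (lam : ℕ → ℕ → ℝ) (α₁ α₂ : ℝ) (n₁ n₂ : ℕ) :
    Lfun lam α₁ α₂ n₁ n₂
    = (∑ i ∈ Finset.range (n₁ + 1), ∑ j ∈ Finset.range (n₂ + 1),
        ENNReal.ofReal (weightedCoeffs α₁ n₁ α₂ n₂ lam i j ^ 2)) ^ ((1:ℝ) / 2)
      + (∑ i ∈ Finset.range (n₁ + 1), ∑' k,
        ENNReal.ofReal (weightedCoeffs α₁ n₁ α₂ n₂ lam i (n₂ + 1 + k) ^ 2)) ^ ((1:ℝ) / 2)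
      + (∑ j ∈ Finset.range (n₂ + 1), ∑' k,
        ENNReal.ofReal (weightedCoeffs α₁ n₁ α₂ n₂ lam (n₁ + 1 + k) j ^ 2)) ^ ((1:ℝ) / 2)
      + (∑' (i : ℕ) (j : ℕ), ENNReal.ofReal
        (weightedCoeffs α₁ n₁ α₂ n₂ lam (n₁ + 1 + i) (n₂ + 1 + j) ^ 2)) ^ ((1:ℝ) / 2) := by
  have htail : ∀ (α : ℝ) (n k : ℕ), modWeight α n (n + 1 + k) = 1 := fun α n k =>
    modWeight_of_lt α (by omega)
  have hhead : ∀ (α : ℝ) (n μ : ℕ), μ ∈ Finset.range (n + 1) →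
      modWeight α n μ ^ 2 = ((2:ℝ) ^ (-(n:ℝ) * α)) ^ 2 * 2 ^ (2 * (μ:ℝ) * α) := fun α n μ hμ => by
    rw [two_rpow_neg_sq_mul, modWeight, if_pos (by simpa [Nat.lt_succ_iff] using hμ)]
  unfold Lfun
  rw [ofReal_mul_rpow_half (by positivity), ofReal_mul_rpow_half (by positivity),
    ofReal_mul_rpow_half (by positivity)]
  simp only [Finset.mul_sum, ← ENNReal.tsum_mul_left]
  refine congrArg₂ _ (congrArg₂ _ (congrArg₂ _ (congrArg (· ^ ((1:ℝ) / 2)) ?_)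
    (congrArg (· ^ ((1:ℝ) / 2)) ?_)) (congrArg (· ^ ((1:ℝ) / 2)) ?_)) ?_
  · refine Finset.sum_congr rfl fun i hi => Finset.sum_congr rfl fun j hj => ?_
    rw [← ENNReal.ofReal_mul (by positivity), weightedCoeffs, mul_pow, mul_pow, hhead _ _ _ hi,
      hhead _ _ _ hj]
    congr 1
    rw [show -((n₁:ℝ) * α₁ + n₂ * α₂) = -(n₁:ℝ) * α₁ + -(n₂:ℝ) * α₂ by ring,
      show 2 * ((i:ℝ) * α₁ + j * α₂) = 2 * i * α₁ + 2 * j * α₂ by ring,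
      Real.rpow_add two_pos, Real.rpow_add two_pos]
    ring
  · refine Finset.sum_congr rfl fun i hi => tsum_congr fun k => ?_
    rw [← ENNReal.ofReal_mul (by positivity), weightedCoeffs, mul_pow, mul_pow, hhead _ _ _ hi,
      htail]
    congr 1
    ring
  · refine Finset.sum_congr rfl fun i hi => tsum_congr fun k => ?_
    rw [← ENNReal.ofReal_mul (by positivity), weightedCoeffs, mul_pow, mul_pow, hhead _ _ _ hi,
      htail]
    congr 1
    ring
  · simp [weightedCoeffs, htail]

lemma sqSum_weightedCoeffs_le_Lfun (lam : ℕ → ℕ → ℝ) (α₁ α₂ : ℝ) (n₁ n₂ : ℕ) :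
    sqSum (weightedCoeffs α₁ n₁ α₂ n₂ lam) ^ ((1:ℝ) / 2) ≤ Lfun lam α₁ α₂ n₁ n₂ := by
  have hadd : ∀ a b : ℝ≥0∞, (a + b) ^ ((1:ℝ) / 2) ≤ a ^ ((1:ℝ) / 2) + b ^ ((1:ℝ) / 2) :=
    fun a b => ENNReal.rpow_add_le_add_rpow a b (by norm_num) (by norm_num)
  rw [Lfun_eq, sqSum_split _ (n₁ + 1) (n₂ + 1)]
  refine (hadd _ _).trans (add_le_add_left ?_ _)
  refine (hadd _ _).trans (add_le_add_left ?_ _)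
  exact hadd _ _

lemma Lfun_le_sqSum_weightedCoeffs (lam : ℕ → ℕ → ℝ) (α₁ α₂ : ℝ) (n₁ n₂ : ℕ) :
    Lfun lam α₁ α₂ n₁ n₂ ≤ 4 * sqSum (weightedCoeffs α₁ n₁ α₂ n₂ lam) ^ ((1:ℝ) / 2) := by
  rw [Lfun_eq, show (4 : ℝ≥0∞) = 1 + 1 + 1 + 1 by norm_num]
  simp only [add_mul, one_mul]
  rw [sqSum_split _ (n₁ + 1) (n₂ + 1)]
  gcongr ?_ + ?_ + ?_ + ?_ <;> refine ENNReal.rpow_le_rpow ?_ (by norm_num)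
  · rw [add_assoc, add_assoc]
    exact le_self_add
  · rw [add_assoc]
    exact le_add_self.trans le_self_add
  · exact le_add_self.trans le_self_add
  · exact le_add_self

/-- For `f ∈ Λ_p`, the mixed modulus of smoothness at dyadic points is equivalent
to the weighted `ℓ²` sums of its lacunary coefficients. -/
theorem modulus_vs_fourier_coefficients_Lambda (p α₁ α₂ : ℝ) (hp : 1 < p)
    (hα₁ : 0 < α₁) (hα₂ : 0 < α₂) :
    ∃ C : ℝ, 0 < C ∧ ∀ (f : ℝ → ℝ → ℝ) (lam : ℕ → ℕ → ℝ) (n₁ n₂ : ℕ),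
      InLambdaClass p f lam →
      mixedMod p α₁ α₂ ((2:ℝ)^n₁)⁻¹ ((2:ℝ)^n₂)⁻¹ f ≤
          ENNReal.ofReal C * Lfun lam α₁ α₂ n₁ n₂ ∧
      Lfun lam α₁ α₂ n₁ n₂ ≤
          ENNReal.ofReal C * mixedMod p α₁ α₂ ((2:ℝ)^n₁)⁻¹ ((2:ℝ)^n₂)⁻¹ f := by
  obtain ⟨K, hK, hequiv⟩ := exists_Lp2Norm_diff_equiv hp hα₁ hα₂
  set A : ℝ := 2 ^ α₁ * 2 ^ α₂ with hA
  set B : ℝ := 4 * ((3:ℝ) ^ α₁ * 3 ^ α₂) with hB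
  have hB0 : 0 < B := by positivity
  refine ⟨max (K * A) (B * K), lt_max_of_lt_left (by positivity), fun f lam n₁ n₂ h => ?_⟩
  constructor
  · refine iSup₂_le fun h₁ hh₁ => iSup₂_le fun h₂ hh₂ => ((hequiv f lam h h₁ h₂).1).trans ?_
    refine le_trans ?_ (mul_le_mul_left (ENNReal.ofReal_le_ofReal (le_max_left _ _)) _)
    rw [ENNReal.ofReal_mul hK.le, mul_assoc]
    refine mul_le_mul_right ((sqSum_mono_of_abs_le (c := A)
      (e := weightedCoeffs α₁ n₁ α₂ n₂ lam) fun i j => ?_).trans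
      (mul_le_mul_right (sqSum_weightedCoeffs_le_Lfun lam α₁ α₂ n₁ n₂) _)) _
    rw [diffCoeffs, weightedCoeffs, abs_mul, abs_mul, abs_mul, abs_mul,
      abs_of_nonneg (diffGain_nonneg _ _ _), abs_of_nonneg (diffGain_nonneg _ _ _),
      abs_of_pos (modWeight_pos _ _ _), abs_of_pos (modWeight_pos _ _ _)]
    calc |lam i j| * diffGain α₁ h₁ (2 ^ i) * diffGain α₂ h₂ (2 ^ j)
        ≤ |lam i j| * (2 ^ α₁ * modWeight α₁ n₁ i) * (2 ^ α₂ * modWeight α₂ n₂ j) := by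
          gcongr
          · exact diffGain_nonneg _ _ _
          · have := modWeight_pos α₁ n₁ i
            positivity
          · exact diffGain_le hα₁ hh₁ i
          · exact diffGain_le hα₂ hh₂ j
      _ = A * (|lam i j| * modWeight α₁ n₁ i * modWeight α₂ n₂ j) := by rw [hA]; ring
  · set s : ℕ → ℝ := fun n => ((2:ℝ) ^ n)⁻¹ * (π / 6) with hs
    have hs_le : ∀ n, |s n| ≤ ((2:ℝ) ^ n)⁻¹ := fun n => by
      rw [hs, abs_of_nonneg (by positivity)]
      exact mul_le_of_le_one_right (by positivity) (by linarith [Real.pi_le_four])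
    have hmod : Lp2Norm p (diffX α₁ (s n₁) (diffY α₂ (s n₂) f))
        ≤ mixedMod p α₁ α₂ ((2:ℝ) ^ n₁)⁻¹ ((2:ℝ) ^ n₂)⁻¹ f :=
      le_iSup₂_of_le (s n₁) (hs_le n₁) (le_iSup₂_of_le (s n₂) (hs_le n₂) le_rfl)
    have hw : sqSum (weightedCoeffs α₁ n₁ α₂ n₂ lam) ^ ((1:ℝ) / 2)
        ≤ ENNReal.ofReal (3 ^ α₁ * 3 ^ α₂)
          * sqSum (diffCoeffs α₁ (s n₁) α₂ (s n₂) lam) ^ ((1:ℝ) / 2) := by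
      refine sqSum_mono_of_abs_le fun i j => ?_
      have hthree : ∀ {α : ℝ} (_ : 0 < α) (n μ : ℕ),
          modWeight α n μ ≤ 3 ^ α * diffGain α (s n) (2 ^ μ) := fun {α} hα n μ => by
        have := le_diffGain hα n μ
        rw [one_div, Real.inv_rpow (by norm_num)] at this
        exact (inv_mul_le_iff₀ (by positivity)).1 this
      rw [diffCoeffs, weightedCoeffs, abs_mul, abs_mul, abs_mul, abs_mul,
        abs_of_nonneg (diffGain_nonneg _ _ _), abs_of_nonneg (diffGain_nonneg _ _ _),
        abs_of_pos (modWeight_pos _ _ _), abs_of_pos (modWeight_pos _ _ _)]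
      calc |lam i j| * modWeight α₁ n₁ i * modWeight α₂ n₂ j
          ≤ |lam i j| * (3 ^ α₁ * diffGain α₁ (s n₁) (2 ^ i))
              * (3 ^ α₂ * diffGain α₂ (s n₂) (2 ^ j)) := by
            gcongr
            · exact (modWeight_pos _ _ _).le
            · have := diffGain_nonneg α₁ (s n₁) (2 ^ i)
              positivity
            · exact hthree hα₁ n₁ i
            · exact hthree hα₂ n₂ j
        _ = _ := by ring
    calc Lfun lam α₁ α₂ n₁ n₂
        ≤ 4 * sqSum (weightedCoeffs α₁ n₁ α₂ n₂ lam) ^ ((1:ℝ) / 2) :=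
          Lfun_le_sqSum_weightedCoeffs _ _ _ _ _
      _ ≤ 4 * (ENNReal.ofReal (3 ^ α₁ * 3 ^ α₂) * (ENNReal.ofReal K
            * mixedMod p α₁ α₂ ((2:ℝ) ^ n₁)⁻¹ ((2:ℝ) ^ n₂)⁻¹ f)) := by
          gcongr
          refine hw.trans ?_
          gcongr
          refine (hequiv f lam h (s n₁) (s n₂)).2.trans ?_
          gcongr
      _ = ENNReal.ofReal (B * K) * mixedMod p α₁ α₂ ((2:ℝ) ^ n₁)⁻¹ ((2:ℝ) ^ n₂)⁻¹ f := by
          rw [ENNReal.ofReal_mul hB0.le, hB, ENNReal.ofReal_mul zero_le_four,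
            ENNReal.ofReal_ofNat]
          ring
      _ ≤ _ := by
          gcongr
          exact le_max_right _ _

end
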